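/- Suppose A and B are positive square real matrices which are strong shift equivalent over ℝ₊. Then A and B are strong shift equivalent over ℝ₊ through positive matrices: there is a finite chain of positive square matrices A = A₀, A₁, …, A_ℓ = B (sizes may vary along the chain) such that A_{i−1} is elementary strong shift equivalent over ℝ₊ to A_i for each i. -/

import Mathlib

open Matrix

/-- All entries of a real matrix lie in the set `S`. -/
def entriesIn {m n : ℕ} (S : Set ℝ) (A : Matrix (Fin m) (Fin n) ℝ) : Prop :=
  ∀ i j, A i j ∈ S

/-- A matrix is positive if every entry is positive. -/
def PosEntries {m n : ℕ} (A : Matrix (Fin m) (Fin n) ℝ) : Prop :=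
  ∀ i j, 0 < A i j

/-- Elementary strong shift equivalence over `S` between square real matrices
(of possibly different sizes). -/
def ESSE (S : Set ℝ) (p q : (n : ℕ) × Matrix (Fin n) (Fin n) ℝ) : Prop :=
  ∃ (R : Matrix (Fin p.1) (Fin q.1) ℝ) (S' : Matrix (Fin q.1) (Fin p.1) ℝ),
    entriesIn S R ∧ entriesIn S S' ∧ p.2 = R * S' ∧ q.2 = S' * R

/-- Strong shift equivalence over `S`: a finite chain of elementary strong shift
equivalences. -/
def SSE (S : Set ℝ) : ((n : ℕ) × Matrix (Fin n) (Fin n) ℝ) →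
    ((n : ℕ) × Matrix (Fin n) (Fin n) ℝ) → Prop :=
  Relation.ReflTransGen (ESSE S)

open Filter
open scoped Topology

set_option linter.unusedSectionVars false

namespace PositiveSSE

section Links

variable {ι κ μ : Type*}

/-- All entries are nonnegative. -/
def NN (M : Matrix ι κ ℝ) : Prop := ∀ i j, 0 ≤ M i j

/-- All entries are positive. -/
def Pos (M : Matrix ι κ ℝ) : Prop := ∀ i j, 0 < M i j

/-- No row vanishes (for nonnegative matrices). -/
def NZR (M : Matrix ι κ ℝ) : Prop := ∀ i, ∃ j, 0 < M i j

/-- No column vanishes (for nonnegative matrices). -/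
def NZC (M : Matrix ι κ ℝ) : Prop := ∀ j, ∃ i, 0 < M i j

theorem Pos.nn {M : Matrix ι κ ℝ} (h : Pos M) : NN M := fun i j => (h i j).le

theorem NN.mul [Fintype κ] {M : Matrix ι κ ℝ} {N : Matrix κ μ ℝ} (hM : NN M) (hN : NN N) :
    NN (M * N) := fun i j => by
  rw [Matrix.mul_apply]
  exact Finset.sum_nonneg fun k _ => mul_nonneg (hM i k) (hN k j)

theorem mul_apply_pos [Fintype κ] {M : Matrix ι κ ℝ} {N : Matrix κ μ ℝ} (hM : NN M) (hN : NN N)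
    {i : ι} {k : κ} {j : μ} (h₁ : 0 < M i k) (h₂ : 0 < N k j) : 0 < (M * N) i j := by
  rw [Matrix.mul_apply]
  exact Finset.sum_pos' (fun k _ => mul_nonneg (hM i k) (hN k j))
    ⟨k, Finset.mem_univ _, mul_pos h₁ h₂⟩

theorem exists_of_mul_apply_pos [Fintype κ] {M : Matrix ι κ ℝ} {N : Matrix κ μ ℝ}
    (hM : NN M) (hN : NN N) {i : ι} {j : μ} (h : 0 < (M * N) i j) :
    ∃ k, 0 < M i k ∧ 0 < N k j := by
  by_contra! hc
  rw [Matrix.mul_apply] at h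
  refine h.ne' (Finset.sum_eq_zero fun k _ => ?_)
  rcases (hM i k).eq_or_lt with h0 | h0
  · rw [← h0, zero_mul]
  · rw [le_antisymm (hc k h0) (hN k j), mul_zero]

theorem Pos.mul_of_nzr [Fintype κ] {M : Matrix ι κ ℝ} {N : Matrix κ μ ℝ} (hM : NN M)
    (hM' : NZR M) (hN : Pos N) : Pos (M * N) := fun i j => by
  obtain ⟨k, hk⟩ := hM' i
  exact mul_apply_pos hM hN.nn hk (hN k j)

theorem nn_one [DecidableEq ι] : NN (1 : Matrix ι ι ℝ) := fun i j => by
  rw [Matrix.one_apply]; split_ifs <;> norm_num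

theorem eventually_pos [Finite ι] [Finite κ] {M : Matrix ι κ ℝ} (h : Pos M) :
    ∀ᶠ N in 𝓝 M, Pos N := by
  unfold Pos
  simp only [eventually_all]
  intro i j
  have : Continuous fun N : Matrix ι κ ℝ => N i j := continuous_id.matrix_elem i j
  exact this.continuousAt.eventually (lt_mem_nhds (h i j))

theorem continuousAt_matrix_inv [Fintype ι] [DecidableEq ι] {M : Matrix ι ι ℝ} (h : M.det ≠ 0) :
    ContinuousAt (fun g : Matrix ι ι ℝ => g⁻¹) M := by
  have : (fun g : Matrix ι ι ℝ => g⁻¹) = fun g => (g.det)⁻¹ • g.adjugate := by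
    ext1 g; rw [Matrix.inv_def, Ring.inverse_eq_inv']
  rw [this]
  exact (continuous_id.matrix_det.continuousAt.inv₀ h).smul
    continuous_id.matrix_adjugate.continuousAt

/-- One step of an elementary strong shift equivalence between positive matrices. -/
def PosStep (p q : (n : ℕ) × Matrix (Fin n) (Fin n) ℝ) : Prop :=
  PosEntries p.2 ∧ PosEntries q.2 ∧ ESSE {x : ℝ | 0 ≤ x} p q

/-- Strong shift equivalence through positive matrices. -/
def PosSSE : ((n : ℕ) × Matrix (Fin n) (Fin n) ℝ) → ((n : ℕ) × Matrix (Fin n) (Fin n) ℝ) → Prop :=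
  Relation.ReflTransGen PosStep

theorem PosStep.symm {p q : (n : ℕ) × Matrix (Fin n) (Fin n) ℝ} (h : PosStep p q) :
    PosStep q p := by
  obtain ⟨h₁, h₂, R, S, hR, hS, e₁, e₂⟩ := h
  exact ⟨h₂, h₁, S, R, hS, hR, e₂, e₁⟩

theorem PosSSE.refl (p : (n : ℕ) × Matrix (Fin n) (Fin n) ℝ) : PosSSE p p :=
  Relation.ReflTransGen.refl

theorem PosSSE.symm {p q : (n : ℕ) × Matrix (Fin n) (Fin n) ℝ} (h : PosSSE p q) :
    PosSSE q p := by
  induction h with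
  | refl => exact PosSSE.refl _
  | tail _ h ih => exact Relation.ReflTransGen.head h.symm ih

theorem PosSSE.trans {p q r : (n : ℕ) × Matrix (Fin n) (Fin n) ℝ} (h : PosSSE p q)
    (h' : PosSSE q r) : PosSSE p r := Relation.ReflTransGen.trans h h'

end Links

section Rep

variable {ι κ : Type*} [Fintype ι] [Fintype κ]

/-- A square matrix over a finite type, reindexed by `Fin n`. -/
noncomputable def rep (A : Matrix ι ι ℝ) : (n : ℕ) × Matrix (Fin n) (Fin n) ℝ :=
  ⟨Fintype.card ι, A.submatrix (Fintype.equivFin ι).symm (Fintype.equivFin ι).symm⟩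

theorem posSSE_rep {R : Matrix ι κ ℝ} {S : Matrix κ ι ℝ} (hR : NN R) (hS : NN S)
    (h₁ : Pos (R * S)) (h₂ : Pos (S * R)) : PosSSE (rep (R * S)) (rep (S * R)) := by
  refine Relation.ReflTransGen.single ⟨fun i j => h₁ _ _, fun i j => h₂ _ _,
    R.submatrix (Fintype.equivFin ι).symm (Fintype.equivFin κ).symm,
    S.submatrix (Fintype.equivFin κ).symm (Fintype.equivFin ι).symm,
    fun i j => hR _ _, fun i j => hS _ _, ?_, ?_⟩
  · exact (Matrix.submatrix_mul_equiv _ _ _ _ _).symm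
  · exact (Matrix.submatrix_mul_equiv _ _ _ _ _).symm

theorem posSSE_rep_fin {n : ℕ} {A : Matrix (Fin n) (Fin n) ℝ} (hA : PosEntries A)
    (e : ι ≃ Fin n) : PosSSE ⟨n, A⟩ (rep (A.submatrix e e)) := by
  let f : Fin (Fintype.card ι) ≃ Fin n := (Fintype.equivFin ι).symm.trans e
  refine Relation.ReflTransGen.single ⟨hA, fun i j => hA _ _, A.submatrix id f,
    (1 : Matrix (Fin n) (Fin n) ℝ).submatrix f id,
    fun i j => (hA _ _).le, fun i j => nn_one _ _, ?_, ?_⟩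
  · have := Matrix.submatrix_mul_equiv A (1 : Matrix (Fin n) (Fin n) ℝ) id f id
    rw [Matrix.mul_one] at this
    exact this.symm
  · have := Matrix.submatrix_mul_equiv (1 : Matrix (Fin n) (Fin n) ℝ) A f (Equiv.refl _) f
    rw [Matrix.one_mul] at this
    exact this.symm

variable [DecidableEq ι]

theorem posSSE_conj {N : Matrix ι ι ℝ} (hN : Pos N) :
    ∀ᶠ g in 𝓝 (1 : Matrix ι ι ℝ), PosSSE (rep N) (rep (g⁻¹ * N * g)) := by
  let V : ℝ → Matrix ι ι ℝ := fun δ => 1 + δ • Matrix.of fun _ _ => 1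
  have hVc : Continuous V := by fun_prop
  have hV0 : V 0 = 1 := by simp [V]
  have hinv : ContinuousAt (fun δ => (V δ)⁻¹) 0 := by
    refine ContinuousAt.comp (f := V) (g := fun g : Matrix ι ι ℝ => g⁻¹) ?_ hVc.continuousAt
    rw [hV0]; exact continuousAt_matrix_inv (by simp)
  have t₁ : Tendsto (fun δ => (V δ)⁻¹ * N) (𝓝 0) (𝓝 N) := by
    have : Tendsto (fun δ => (V δ)⁻¹ * N) (𝓝 0) (𝓝 ((V 0)⁻¹ * N)) :=
      hinv.mul continuousAt_const
    simpa [hV0] using this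
  have t₂ : Tendsto (fun δ => (V δ)⁻¹ * N * V δ) (𝓝 0) (𝓝 N) := by
    have : Tendsto (fun δ => (V δ)⁻¹ * N * V δ) (𝓝 0) (𝓝 ((V 0)⁻¹ * N * V 0)) :=
      (hinv.mul continuousAt_const).mul hVc.continuousAt
    simpa [hV0] using this
  have t₃ : ∀ᶠ δ in 𝓝 (0 : ℝ), (V δ).det ≠ 0 := by
    have : ContinuousAt (fun δ => (V δ).det) 0 := hVc.matrix_det.continuousAt
    exact this.eventually_ne (by simp [hV0])
  obtain ⟨δ, ⟨⟨p₁, p₂⟩, p₃⟩, hδ⟩ := ((((t₁.eventually (eventually_pos hN)).and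
    (t₂.eventually (eventually_pos hN))).and t₃).filter_mono
      nhdsWithin_le_nhds |>.and (self_mem_nhdsWithin (s := Set.Ioi (0:ℝ)))).exists
  have hVpos : Pos (V δ) := fun i j => by
    have := nn_one (ι := ι) i j
    have h' : (0:ℝ) < δ := hδ
    simp only [V, Matrix.add_apply, Matrix.smul_apply, Matrix.of_apply, smul_eq_mul, mul_one]
    linarith
  have hc : ContinuousAt (fun g : Matrix ι ι ℝ => g⁻¹) 1 := continuousAt_matrix_inv (by simp)
  have s₁ : Tendsto (fun g : Matrix ι ι ℝ => g⁻¹ * N * g) (𝓝 1) (𝓝 N) := by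
    have : Tendsto (fun g : Matrix ι ι ℝ => g⁻¹ * N * g) (𝓝 1) (𝓝 (1⁻¹ * N * 1)) :=
      (hc.mul continuousAt_const).mul continuousAt_id
    simpa using this
  have s₂ : Tendsto (fun g : Matrix ι ι ℝ => g⁻¹ * V δ) (𝓝 1) (𝓝 (V δ)) := by
    have : Tendsto (fun g : Matrix ι ι ℝ => g⁻¹ * V δ) (𝓝 1) (𝓝 (1⁻¹ * V δ)) :=
      hc.mul continuousAt_const
    simpa using this
  have s₃ : Tendsto (fun g : Matrix ι ι ℝ => (V δ)⁻¹ * N * g) (𝓝 1) (𝓝 ((V δ)⁻¹ * N)) := by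
    have : Tendsto (fun g : Matrix ι ι ℝ => (V δ)⁻¹ * N * g) (𝓝 1) (𝓝 ((V δ)⁻¹ * N * 1)) :=
      continuousAt_const.mul continuousAt_id
    simpa using this
  have s₄ : ∀ᶠ g in 𝓝 (1 : Matrix ι ι ℝ), g.det ≠ 0 :=
    (continuous_id.matrix_det.continuousAt (x := (1 : Matrix ι ι ℝ))).eventually_ne (by simp)
  filter_upwards [s₁.eventually (eventually_pos hN), s₂.eventually (eventually_pos hVpos),
    s₃.eventually (eventually_pos p₁), s₄] with g q₁ q₂ q₃ q₄
  have u₁ : V δ * ((V δ)⁻¹ * N) = N := Matrix.mul_nonsing_inv_cancel_left _ _ p₃.isUnit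
  have u₂ : g⁻¹ * V δ * ((V δ)⁻¹ * N * g) = g⁻¹ * N * g := by
    calc _ = g⁻¹ * (V δ * ((V δ)⁻¹ * N)) * g := by simp only [Matrix.mul_assoc]
      _ = _ := by rw [u₁]
  have u₃ : (V δ)⁻¹ * N * g * (g⁻¹ * V δ) = (V δ)⁻¹ * N * V δ := by
    calc _ = (V δ)⁻¹ * N * (g * (g⁻¹ * V δ)) := by simp only [Matrix.mul_assoc]
      _ = _ := by rw [Matrix.mul_nonsing_inv_cancel_left _ _ q₄.isUnit]
  have r₁ := posSSE_rep hVpos.nn p₁.nn (by rwa [u₁]) p₂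
  have r₂ := posSSE_rep q₂.nn q₃.nn (by rwa [u₂]) (by rwa [u₃])
  rw [u₁] at r₁
  rw [u₂, u₃] at r₂
  exact r₁.trans r₂.symm

end Rep

section Classes

variable {ι κ : Type*} [Fintype ι] [DecidableEq ι] [Fintype κ] [DecidableEq κ]

theorem det_one_add_smul_ne (X : Matrix ι ι ℝ) : ∀ᶠ s : ℝ in 𝓝 0, (1 + s • X).det ≠ 0 := by
  have : Continuous fun s : ℝ => (1 + s • X).det := by
    refine Continuous.matrix_det ?_; fun_prop
  exact this.continuousAt.eventually_ne (by simp)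

theorem conj_one_add_smul {R : Matrix ι κ ℝ} {X : Matrix ι ι ℝ} {X' : Matrix κ κ ℝ} {s : ℝ}
    (h : (1 + s • X).det ≠ 0) :
    (1 + s • X)⁻¹ * R * (1 + s • X') = R + s • ((1 + s • X)⁻¹ * (R * X' - X * R)) := by
  have e : R * (1 + s • X') = (1 + s • X) * R + s • (R * X' - X * R) := by
    simp only [Matrix.mul_add, Matrix.add_mul, Matrix.mul_one, Matrix.one_mul, Matrix.mul_smul,
      Matrix.smul_mul, smul_sub]
    abel
  rw [Matrix.mul_assoc, e, Matrix.mul_add, Matrix.nonsing_inv_mul_cancel_left _ _ h.isUnit,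
    Matrix.mul_smul]

theorem eventually_conj_pos {R : Matrix ι κ ℝ} {X : Matrix ι ι ℝ} {X' : Matrix κ κ ℝ}
    (hR : NN R) (h : ∀ i k, R i k = 0 → 0 < (R * X' - X * R) i k) :
    ∀ᶠ p : ℝ × Matrix ι κ ℝ in 𝓝 (0, R), 0 ≤ p.1 → NN p.2 → (0 < p.1 ∨ Pos p.2) →
      Pos ((1 + p.1 • X)⁻¹ * p.2 * (1 + p.1 • X')) := by
  have hinv : ContinuousAt (fun p : ℝ × Matrix ι κ ℝ => (1 + p.1 • X)⁻¹) (0, R) := by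
    refine ContinuousAt.comp (f := fun p : ℝ × Matrix ι κ ℝ => 1 + p.1 • X)
      (g := fun g : Matrix ι ι ℝ => g⁻¹) (continuousAt_matrix_inv (by simp)) ?_
    exact Continuous.continuousAt (by fun_prop)
  have hmul : Continuous fun q : Matrix ι ι ℝ × Matrix ι κ ℝ => q.1 * q.2 :=
    continuous_fst.matrix_mul continuous_snd
  have c₁ : ContinuousAt (fun p : ℝ × Matrix ι κ ℝ => p.2 * (1 + p.1 • X')) (0, R) :=
    (continuous_snd.matrix_mul (by fun_prop)).continuousAt
  have c₂ : ContinuousAt (fun p : ℝ × Matrix ι κ ℝ => p.2 * X' - X * p.2) (0, R) :=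
    ((continuous_snd.matrix_mul continuous_const).sub
      (continuous_const.matrix_mul continuous_snd)).continuousAt
  have d₁ : Tendsto (fun p : ℝ × Matrix ι κ ℝ => (1 + p.1 • X)⁻¹ * (p.2 * (1 + p.1 • X')))
      (𝓝 (0, R)) (𝓝 R) := by
    have := (hmul.tendsto (1, R)).comp
      ((by simpa using hinv.tendsto.prodMk_nhds c₁.tendsto :
        Tendsto (fun p : ℝ × Matrix ι κ ℝ => ((1 + p.1 • X)⁻¹, p.2 * (1 + p.1 • X'))) (𝓝 (0, R))
          (𝓝 (1, R))))
    simpa [Function.comp_def] using this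
  have d₂ : Tendsto (fun p : ℝ × Matrix ι κ ℝ => (1 + p.1 • X)⁻¹ * (p.2 * X' - X * p.2))
      (𝓝 (0, R)) (𝓝 (R * X' - X * R)) := by
    have := (hmul.tendsto (1, R * X' - X * R)).comp
      ((by simpa using hinv.tendsto.prodMk_nhds c₂.tendsto :
        Tendsto (fun p : ℝ × Matrix ι κ ℝ => ((1 + p.1 • X)⁻¹, p.2 * X' - X * p.2)) (𝓝 (0, R))
          (𝓝 (1, R * X' - X * R))))
    simpa [Function.comp_def] using this
  have hdet : ∀ᶠ p : ℝ × Matrix ι κ ℝ in 𝓝 (0, R), (1 + p.1 • X).det ≠ 0 :=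
    (continuous_fst.tendsto (0, R)).eventually (det_one_add_smul_ne X)
  have key : ∀ i k, ∀ᶠ p : ℝ × Matrix ι κ ℝ in 𝓝 (0, R), 0 ≤ p.1 → NN p.2 →
      (0 < p.1 ∨ Pos p.2) → 0 < ((1 + p.1 • X)⁻¹ * p.2 * (1 + p.1 • X') : Matrix ι κ ℝ) i k := by
    intro i k
    have he : ∀ N : Matrix ι κ ℝ, Tendsto (fun M : Matrix ι κ ℝ => M i k) (𝓝 N) (𝓝 (N i k)) :=
      fun N => (continuous_id.matrix_elem i k).tendsto N
    rcases (hR i k).eq_or_lt with h0 | h0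
    · filter_upwards [hdet, ((he _).comp d₂).eventually (lt_mem_nhds (h i k h0.symm))]
        with p hp hq h₁ h₂ h₃
      rw [conj_one_add_smul hp, Matrix.add_apply, Matrix.smul_apply, smul_eq_mul]
      have hq' : 0 < ((1 + p.1 • X)⁻¹ * (p.2 * X' - X * p.2)) i k := hq
      rcases h₃ with h₃ | h₃
      · have := h₂ i k
        positivity
      · have := h₃ i k
        positivity
    · filter_upwards [((he _).comp d₁).eventually (lt_mem_nhds h0)] with p hp _ _ _
      rw [Matrix.mul_assoc]
      exact hp
  have key' : ∀ᶠ p : ℝ × Matrix ι κ ℝ in 𝓝 (0, R), ∀ i k, 0 ≤ p.1 → NN p.2 →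
      (0 < p.1 ∨ Pos p.2) → 0 < ((1 + p.1 • X)⁻¹ * p.2 * (1 + p.1 • X') : Matrix ι κ ℝ) i k := by
    simpa only [eventually_all] using key
  filter_upwards [key'] with p hp h₁ h₂ h₃ i k using hp i k h₁ h₂ h₃

/-- The matrix `M` conjugated by `g`. -/
noncomputable def conj (g M : Matrix ι ι ℝ) : Matrix ι ι ℝ := g⁻¹ * M * g

theorem conj_conj (g u M : Matrix ι ι ℝ) : conj u (conj g M) = conj (g * u) M := by
  simp only [conj, Matrix.mul_inv_rev, Matrix.mul_assoc]

theorem conj_eq_conj_conj {g : Matrix ι ι ℝ} (hg : g.det ≠ 0) (h M : Matrix ι ι ℝ) :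
    conj h M = conj (g⁻¹ * h) (conj g M) := by
  rw [conj_conj, Matrix.mul_nonsing_inv_cancel_left _ _ hg.isUnit]

theorem conj_one (M : Matrix ι ι ℝ) : conj 1 M = M := by simp [conj]

theorem tendsto_conj (M : Matrix ι ι ℝ) : Tendsto (fun g => conj g M) (𝓝 1) (𝓝 M) := by
  have hc : ContinuousAt (fun g : Matrix ι ι ℝ => g⁻¹) 1 := continuousAt_matrix_inv (by simp)
  have : Tendsto (fun g : Matrix ι ι ℝ => g⁻¹ * M * g) (𝓝 1) (𝓝 (1⁻¹ * M * 1)) :=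
    (hc.mul continuousAt_const).mul continuousAt_id
  simpa [conj] using this

/-- `M` is nonnegative, and some infinitesimal conjugation makes its zero entries positive. -/
def Deformable (M : Matrix ι ι ℝ) : Prop :=
  NN M ∧ ∃ X : Matrix ι ι ℝ, ∀ i j, M i j = 0 → 0 < (M * X - X * M) i j

/-- All positive matrices conjugate to `M` by a matrix close to `1` are linked to `N`. -/
def LinkedTo (M : Matrix ι ι ℝ) (N : (n : ℕ) × Matrix (Fin n) (Fin n) ℝ) : Prop :=
  ∀ᶠ g in 𝓝 (1 : Matrix ι ι ℝ), Pos (conj g M) → PosSSE (rep (conj g M)) N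

theorem tendsto_one_add_smul (X : Matrix ι ι ℝ) :
    Tendsto (fun s : ℝ => 1 + s • X) (𝓝[>] 0) (𝓝 1) := by
  have : Continuous fun s : ℝ => 1 + s • X := by fun_prop
  have := this.tendsto 0
  rw [zero_smul, add_zero] at this
  exact this.mono_left nhdsWithin_le_nhds

theorem eventually_pos_of_dir {R : Matrix ι κ ℝ} {X : Matrix ι ι ℝ} {X' : Matrix κ κ ℝ}
    (hR : NN R) (h : ∀ i k, R i k = 0 → 0 < (R * X' - X * R) i k) :
    ∀ᶠ s : ℝ in 𝓝[>] 0, Pos ((1 + s • X)⁻¹ * R * (1 + s • X')) := by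
  have := (eventually_conj_pos hR h).curry_nhds
  filter_upwards [this.filter_mono nhdsWithin_le_nhds, self_mem_nhdsWithin] with s hs hs'
  exact hs.self_of_nhds (le_of_lt hs') hR (Or.inl hs')

theorem Deformable.frequently_pos {M : Matrix ι ι ℝ} (h : Deformable M) :
    ∃ᶠ g in 𝓝 (1 : Matrix ι ι ℝ), Pos (conj g M) := by
  obtain ⟨hM, X, hX⟩ := h
  exact (tendsto_one_add_smul X).frequently (eventually_pos_of_dir hM hX).frequently

theorem Deformable.exists_linkedTo {M : Matrix ι ι ℝ} (h : Deformable M) :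
    ∃ N, LinkedTo M N := by
  obtain ⟨hM, X, hX⟩ := h
  have h1 := eventually_conj_pos hM hX
  rw [nhds_prod_eq, eventually_prod_iff] at h1
  obtain ⟨pa, hpa, pb, hpb, hp⟩ := h1
  obtain ⟨ε, hε, hε'⟩ := Metric.eventually_nhds_iff.1 (hpa.and (det_one_add_smul_ne X))
  obtain ⟨s₀, hs₀, hs₀'⟩ := exists_between hε
  have hI : ∀ s ∈ Set.Icc 0 s₀, pa s ∧ (1 + s • X).det ≠ 0 := fun s hs => hε' (by
    rw [Real.dist_eq, sub_zero, abs_of_nonneg hs.1]; exact hs.2.trans_lt hs₀')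
  have h0 : s₀ ∈ Set.Icc 0 s₀ := ⟨hs₀.le, le_rfl⟩
  have hN : Pos (conj (1 + s₀ • X) M) :=
    hp (hI s₀ h0).1 hpb.self_of_nhds hs₀.le hM (Or.inl hs₀)
  refine ⟨rep (conj (1 + s₀ • X) M), ?_⟩
  have tend : Tendsto (fun u => (1 + s₀ • X)⁻¹ * (u * (1 + s₀ • X))) (𝓝 1) (𝓝 1) := by
    have hc : Continuous fun u : Matrix ι ι ℝ => (1 + s₀ • X)⁻¹ * (u * (1 + s₀ • X)) := by
      fun_prop
    have := hc.tendsto 1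
    rwa [Matrix.one_mul, Matrix.nonsing_inv_mul _ (hI s₀ h0).2.isUnit] at this
  filter_upwards [(tendsto_conj M).eventually hpb, tend.eventually (posSSE_conj hN)]
    with u hu hu' hpos
  have hfin : PosSSE (rep (conj (1 + s₀ • X) (conj u M))) (rep (conj (1 + s₀ • X) M)) := by
    rw [conj_conj, conj_eq_conj_conj (hI s₀ h0).2]
    exact hu'.symm
  refine PosSSE.trans ?_ hfin
  have path := isPreconnected_Icc.induction₂ (s := Set.Icc 0 s₀)
    (fun s s' => PosSSE (rep (conj (1 + s • X) (conj u M))) (rep (conj (1 + s' • X) (conj u M))))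
    (fun s hs => ?_) (fun _ _ _ _ _ _ h h' => h.trans h') (fun _ _ _ _ h => h.symm)
    (⟨le_rfl, hs₀.le⟩ : (0:ℝ) ∈ Set.Icc 0 s₀) h0
  · simpa [conj_one] using path
  · have hpos' : Pos (conj (1 + s • X) (conj u M)) :=
      hp (hI s hs).1 hu hs.1 hpos.nn (Or.inr hpos)
    have t : Tendsto (fun s' : ℝ => (1 + s • X)⁻¹ * (1 + s' • X)) (𝓝[Set.Icc 0 s₀] s) (𝓝 1) := by
      have hc : Continuous fun s' : ℝ => (1 + s • X)⁻¹ * (1 + s' • X) := by fun_prop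
      have := hc.tendsto s
      rw [Matrix.nonsing_inv_mul _ (hI s hs).2.isUnit] at this
      exact this.mono_left nhdsWithin_le_nhds
    filter_upwards [t.eventually (posSSE_conj hpos')] with s' hs'
    rw [conj_eq_conj_conj (hI s hs).2 (1 + s' • X)]
    exact hs'

/-- Two deformable matrices whose nearby positive conjugates are all linked. -/
def Equi (A : Matrix ι ι ℝ) (B : Matrix κ κ ℝ) : Prop :=
  Deformable A ∧ Deformable B ∧ ∃ N, LinkedTo A N ∧ LinkedTo B N

theorem Equi.symm {A : Matrix ι ι ℝ} {B : Matrix κ κ ℝ} (h : Equi A B) : Equi B A :=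
  ⟨h.2.1, h.1, h.2.2.imp fun _ h => h.symm⟩

theorem Equi.trans {μ : Type*} [Fintype μ] [DecidableEq μ] {A : Matrix ι ι ℝ} {B : Matrix κ κ ℝ}
    {C : Matrix μ μ ℝ} (h : Equi A B) (h' : Equi B C) : Equi A C := by
  obtain ⟨hA, hB, N, h₁, h₂⟩ := h
  obtain ⟨-, hC, N', h₃, h₄⟩ := h'
  obtain ⟨g, hg, hg₂, hg₃⟩ := (hB.frequently_pos.and_eventually (h₂.and h₃)).exists
  have := (hg₂ hg).symm.trans (hg₃ hg)
  exact ⟨hA, hC, N', h₁.mono fun g h hg => (h hg).trans this, h₄⟩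

theorem Pos.deformable {A : Matrix ι ι ℝ} (h : Pos A) : Deformable A :=
  ⟨h.nn, 0, fun i j h0 => absurd h0 (h i j).ne'⟩

theorem Equi.posSSE {A : Matrix ι ι ℝ} {B : Matrix κ κ ℝ} (h : Equi A B) (hA : Pos A)
    (hB : Pos B) : PosSSE (rep A) (rep B) := by
  obtain ⟨-, -, N, h₁, h₂⟩ := h
  have a := h₁.self_of_nhds
  have b := h₂.self_of_nhds
  rw [conj_one] at a b
  exact (a hA).trans (b hB).symm

/-- `X` and `X'` give a simultaneous infinitesimal deformation of `R` and `S` under which all zero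
entries become positive. -/
def DirPair (R : Matrix ι κ ℝ) (S : Matrix κ ι ℝ) (X : Matrix ι ι ℝ) (X' : Matrix κ κ ℝ) : Prop :=
  (∀ i k, R i k = 0 → 0 < (R * X' - X * R) i k) ∧ ∀ k i, S k i = 0 → 0 < (S * X - X' * S) k i

theorem DirPair.symm {R : Matrix ι κ ℝ} {S : Matrix κ ι ℝ} {X : Matrix ι ι ℝ} {X' : Matrix κ κ ℝ}
    (h : DirPair R S X X') : DirPair S R X' X := ⟨h.2, h.1⟩

theorem DirPair.deformable {R : Matrix ι κ ℝ} {S : Matrix κ ι ℝ} {X : Matrix ι ι ℝ}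
    {X' : Matrix κ κ ℝ} (h : DirPair R S X X') (hR : NN R) (hS : NN S) (hR' : NZR R) :
    Deformable (R * S) := by
  refine ⟨hR.mul hS, X, fun i j h0 => ?_⟩
  have e : R * S * X - X * (R * S) = (R * X' - X * R) * S + R * (S * X - X' * S) := by
    simp only [Matrix.mul_sub, Matrix.sub_mul, Matrix.mul_assoc]
    abel
  have hz : ∀ k, R i k * S k j = 0 := by
    rw [Matrix.mul_apply] at h0
    exact fun k => (Finset.sum_eq_zero_iff_of_nonneg
      (fun k _ => mul_nonneg (hR i k) (hS k j))).1 h0 k (Finset.mem_univ k)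
  rw [e, Matrix.add_apply, Matrix.mul_apply, Matrix.mul_apply]
  refine add_pos_of_nonneg_of_pos (Finset.sum_nonneg fun k _ => ?_)
    (Finset.sum_pos' (fun k _ => ?_) ?_)
  · rcases (hS k j).eq_or_lt with hs | hs
    · rw [← hs, mul_zero]
    · exact mul_nonneg (h.1 i k ((mul_eq_zero.1 (hz k)).resolve_right hs.ne')).le hs.le
  · rcases (hR i k).eq_or_lt with hr | hr
    · rw [← hr, zero_mul]
    · exact mul_nonneg hr.le (h.2 k j ((mul_eq_zero.1 (hz k)).resolve_left hr.ne')).le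
  · obtain ⟨k, hk⟩ := hR' i
    exact ⟨k, Finset.mem_univ k,
      mul_pos hk (h.2 k j ((mul_eq_zero.1 (hz k)).resolve_left hk.ne'))⟩

theorem DirPair.equi {R : Matrix ι κ ℝ} {S : Matrix κ ι ℝ} {X : Matrix ι ι ℝ}
    {X' : Matrix κ κ ℝ} (h : DirPair R S X X') (hR : NN R) (hS : NN S) (hR' : NZR R)
    (hS' : NZR S) : Equi (R * S) (S * R) := by
  have d₁ := h.deformable hR hS hR'
  have d₂ := h.symm.deformable hS hR hS'
  obtain ⟨N, hN⟩ := d₁.exists_linkedTo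
  obtain ⟨N', hN'⟩ := d₂.exists_linkedTo
  refine ⟨d₁, d₂, N, hN, ?_⟩
  obtain ⟨s, ⟨⟨p₁, p₂⟩, p₃, p₄⟩, p₅, p₆⟩ :=
    (((eventually_pos_of_dir hR h.1).and (eventually_pos_of_dir hS h.2)).and
      (((tendsto_one_add_smul X).eventually hN).and
        ((tendsto_one_add_smul X').eventually hN')) |>.and
      (((det_one_add_smul_ne X).and (det_one_add_smul_ne X')).filter_mono
        nhdsWithin_le_nhds)).exists
  have e₁ : (1 + s • X)⁻¹ * R * (1 + s • X') * ((1 + s • X')⁻¹ * S * (1 + s • X)) =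
      conj (1 + s • X) (R * S) := by
    calc _ = (1 + s • X)⁻¹ * R * ((1 + s • X') * ((1 + s • X')⁻¹ * (S * (1 + s • X)))) := by
          simp only [Matrix.mul_assoc]
      _ = _ := by
          rw [Matrix.mul_nonsing_inv_cancel_left _ _ p₆.isUnit]
          simp only [Matrix.mul_assoc, conj]
  have e₂ : (1 + s • X')⁻¹ * S * (1 + s • X) * ((1 + s • X)⁻¹ * R * (1 + s • X')) =
      conj (1 + s • X') (S * R) := by
    calc _ = (1 + s • X')⁻¹ * S * ((1 + s • X) * ((1 + s • X)⁻¹ * (R * (1 + s • X')))) := by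
          simp only [Matrix.mul_assoc]
      _ = _ := by
          rw [Matrix.mul_nonsing_inv_cancel_left _ _ p₅.isUnit]
          simp only [Matrix.mul_assoc, conj]
  have q₁ : Pos (conj (1 + s • X) (R * S)) := fun i j => by
    obtain ⟨k, -⟩ := hR' i
    rw [← e₁]
    exact mul_apply_pos p₁.nn p₂.nn (p₁ i k) (p₂ k j)
  have q₂ : Pos (conj (1 + s • X') (S * R)) := fun i j => by
    obtain ⟨k, -⟩ := hS' i
    rw [← e₂]
    exact mul_apply_pos p₂.nn p₁.nn (p₂ i k) (p₁ k j)
  have link := posSSE_rep p₁.nn p₂.nn (by rwa [e₁]) (by rwa [e₂])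
  rw [e₁, e₂] at link
  have := ((p₄ q₂).symm.trans link.symm).trans (p₃ q₁)
  exact hN'.mono fun g h hg => (h hg).trans this

end Classes

section FullRow

variable {ι κ μ : Type*} [Fintype ι] [DecidableEq ι] [Fintype κ] [DecidableEq κ] [Fintype μ]

theorem NN.pow {M : Matrix ι ι ℝ} (h : NN M) (k : ℕ) : NN (M ^ k) := by
  induction k with
  | zero => rw [pow_zero]; exact nn_one
  | succ k ih => rw [pow_succ]; exact ih.mul h

/-- If `R` has a positive row which every index can reach, then `(R, S)` has a deforming pair. -/
theorem exists_dirPair {R : Matrix ι κ ℝ} {S : Matrix κ ι ℝ} (hR : NN R) (hS : NN S)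
    (hS' : NZR S) {x : ι} (hx : ∀ k, 0 < R x k)
    (hreach : ∀ i, ∃ k, 0 < ((R * S) ^ k : Matrix ι ι ℝ) i x) :
    ∃ X X', DirPair R S X X' := by
  have hA := hR.mul hS
  choose f hf using hreach
  set K := Finset.univ.sup f with hK
  set b : ℝ := 1 + (∑ i, ∑ k, R i k + ∑ k, ∑ i, S k i) with hb
  have nR : 0 ≤ ∑ i, ∑ k, R i k :=
    Finset.sum_nonneg fun i _ => Finset.sum_nonneg fun k _ => hR i k
  have nS : 0 ≤ ∑ k, ∑ i, S k i :=
    Finset.sum_nonneg fun k _ => Finset.sum_nonneg fun i _ => hS k i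
  have hb0 : 0 < b := by positivity
  have bR : ∀ k, ∑ i, R i k ≤ b := fun k => by
    have : ∑ i, R i k ≤ ∑ i, ∑ k, R i k := Finset.sum_le_sum fun i _ =>
      Finset.single_le_sum (fun k _ => hR i k) (Finset.mem_univ k)
    linarith
  have bS : ∀ i, ∑ k, S k i ≤ b := fun i => by
    have : ∑ k, S k i ≤ ∑ k, ∑ i, S k i := Finset.sum_le_sum fun k _ =>
      Finset.single_le_sum (fun i _ => hS k i) (Finset.mem_univ i)
    linarith
  set η : ℝ := 1 / (2 * b) with hη
  set δ : ℝ := 1 / (4 * b * b) with hδ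
  have hη0 : 0 < η := by positivity
  have hδ0 : 0 < δ := by positivity
  let a : ι → ℝ := fun i => ∑ k ∈ Finset.range (K + 1), δ ^ k * ((R * S) ^ k : Matrix ι ι ℝ) i x
  have ha : ∀ i, 0 < a i := fun i => by
    refine Finset.sum_pos' (fun k _ => mul_nonneg (by positivity) (hA.pow k i x))
      ⟨f i, ?_, mul_pos (by positivity) (hf i)⟩
    rw [Finset.mem_range, Nat.lt_succ_iff]
    exact Finset.le_sup (Finset.mem_univ i)
  have hAa : ∀ i, i ≠ x → a i ≤ δ * ∑ j, (R * S) i j * a j := fun i hi => by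
    have e : δ * ∑ j, (R * S) i j * a j =
        ∑ k ∈ Finset.range (K + 1), δ ^ (k + 1) * ((R * S) ^ (k + 1) : Matrix ι ι ℝ) i x := by
      simp only [a, Finset.mul_sum]
      rw [Finset.sum_comm]
      refine Finset.sum_congr rfl fun k _ => ?_
      rw [pow_succ' (R * S), Matrix.mul_apply (M := R * S), Finset.mul_sum]
      refine Finset.sum_congr rfl fun j _ => ?_
      ring
    rw [e, Finset.sum_range_succ]
    simp only [a]
    rw [Finset.sum_range_succ']
    have h1 : ((R * S) ^ 0 : Matrix ι ι ℝ) i x = 0 := by rw [pow_zero, Matrix.one_apply_ne hi]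
    rw [h1, mul_zero, add_zero, le_add_iff_nonneg_right]
    exact mul_nonneg (by positivity) (hA.pow _ i x)
  let a' : κ → ℝ := fun k => η * ∑ i, S k i * a i
  have hSa : ∀ k, 0 < ∑ i, S k i * a i := fun k => by
    obtain ⟨i, hi⟩ := hS' k
    exact Finset.sum_pos' (fun i _ => mul_nonneg (hS k i) (ha i).le)
      ⟨i, Finset.mem_univ i, mul_pos hi (ha i)⟩
  refine ⟨Matrix.of fun i _ => a i, Matrix.of fun k _ => a' k, fun i k h0 => ?_, fun k i _ => ?_⟩
  · have hi : i ≠ x := by rintro rfl; exact (hx k).ne' h0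
    simp only [Matrix.sub_apply, Matrix.mul_apply, Matrix.of_apply]
    rw [← Finset.mul_sum, sub_pos]
    have e : ∑ l, R i l * a' l = η * ∑ j, (R * S) i j * a j := by
      simp only [a', Matrix.mul_apply, Finset.mul_sum, Finset.sum_mul]
      rw [Finset.sum_comm]
      exact Finset.sum_congr rfl fun _ _ => Finset.sum_congr rfl fun _ _ => by ring
    rw [e]
    have h₁ := hAa i hi
    have h₂ := ha i
    set T := ∑ j, (R * S) i j * a j
    have h₃ : 4 * b * b * a i ≤ T := by
      rw [hδ, one_div, ← div_eq_inv_mul, le_div_iff₀ (by positivity)] at h₁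
      linarith
    have h₄ : 2 * b * a i ≤ η * T := by
      rw [hη, one_div, ← div_eq_inv_mul, le_div_iff₀ (by positivity)]
      linarith
    have h₅ := mul_le_mul_of_nonneg_left (bR k) h₂.le
    have h₆ : 0 < a i * b := by positivity
    linarith
  · simp only [Matrix.sub_apply, Matrix.mul_apply, Matrix.of_apply]
    rw [← Finset.mul_sum, sub_pos]
    have h₁ := hSa k
    simp only [a']
    set T := ∑ i, S k i * a i
    have h₂ := mul_le_mul_of_nonneg_left (bS i) (mul_pos hη0 h₁).le
    have h₃ : η * T * b = T / 2 := by
      rw [hη]; field_simp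
    linarith

/-- Primitivity: all large powers are positive. -/
def Prim (M : Matrix ι ι ℝ) : Prop := ∀ᶠ k in atTop, Pos (M ^ k)

theorem Prim.nzr {M : Matrix ι ι ℝ} (h : Prim M) (hM : NN M) : NZR M := fun i => by
  obtain ⟨k, hk⟩ := ((tendsto_add_atTop_nat 1).eventually h).exists
  rw [pow_succ'] at hk
  obtain ⟨j, hj, -⟩ := exists_of_mul_apply_pos hM (hM.pow k) (hk i i)
  exact ⟨j, hj⟩

theorem Prim.nzc {M : Matrix ι ι ℝ} (h : Prim M) (hM : NN M) : NZC M := fun i => by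
  obtain ⟨k, hk⟩ := ((tendsto_add_atTop_nat 1).eventually h).exists
  rw [pow_succ] at hk
  obtain ⟨j, -, hj⟩ := exists_of_mul_apply_pos (hM.pow k) hM (hk i i)
  exact ⟨j, hj⟩

theorem mul_pow_mul (R : Matrix ι κ ℝ) (S : Matrix κ ι ℝ) (k : ℕ) :
    (S * R) ^ k * S = S * (R * S) ^ k := by
  induction k with
  | zero => simp
  | succ k ih =>
    rw [pow_succ', Matrix.mul_assoc, ih, pow_succ']
    simp only [Matrix.mul_assoc]

theorem NZR.mul {R : Matrix ι κ ℝ} {S : Matrix κ μ ℝ} (hR : NN R) (hS : NN S) (hR' : NZR R)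
    (hS' : NZR S) : NZR (R * S) := fun i => by
  obtain ⟨k, hk⟩ := hR' i
  obtain ⟨j, hj⟩ := hS' k
  exact ⟨j, mul_apply_pos hR hS hk hj⟩

theorem Pos.mul_of_nzc {M : Matrix μ ι ℝ} {N : Matrix ι κ ℝ} (hM : Pos M) (hN : NN N)
    (hN' : NZC N) : Pos (M * N) := fun i j => by
  obtain ⟨k, hk⟩ := hN' j
  exact mul_apply_pos hM.nn hN (hM i k) hk

theorem Prim.swap {R : Matrix ι κ ℝ} {S : Matrix κ ι ℝ} (h : Prim (R * S)) (hR : NN R)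
    (hS : NN S) (hR' : NZC R) (hS' : NZR S) : Prim (S * R) := by
  obtain ⟨n, hn⟩ := eventually_atTop.1 h
  refine eventually_atTop.2 ⟨n + 1, fun k hk => ?_⟩
  obtain ⟨l, rfl⟩ : ∃ l, k = l + 1 := ⟨k - 1, by omega⟩
  rw [pow_succ, ← Matrix.mul_assoc, mul_pow_mul]
  exact (Pos.mul_of_nzr hS hS' (hn l (by omega))).mul_of_nzc hR hR'

theorem NZR.of_mul {R : Matrix ι κ ℝ} {S : Matrix κ μ ℝ} (hR : NN R) (hS : NN S)
    (h : NZR (R * S)) : NZR R := fun i => by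
  obtain ⟨j, hj⟩ := h i
  exact (exists_of_mul_apply_pos hR hS hj).imp fun _ h => h.1

theorem NZC.of_mul {R : Matrix ι κ ℝ} {S : Matrix κ μ ℝ} (hR : NN R) (hS : NN S)
    (h : NZC (R * S)) : NZC S := fun j => by
  obtain ⟨i, hi⟩ := h j
  exact (exists_of_mul_apply_pos hR hS hi).imp fun _ h => h.2

theorem equi_of_pos_row {R : Matrix ι κ ℝ} {S : Matrix κ ι ℝ} (hR : NN R) (hS : NN S)
    (hRS : Prim (R * S)) (hSR : Prim (S * R)) {x : ι} (hx : ∀ k, 0 < R x k) :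
    Equi (R * S) (S * R) := by
  have hS' := (hSR.nzr (hS.mul hR)).of_mul hS hR
  obtain ⟨k, hk⟩ := hRS.exists
  obtain ⟨X, X', h⟩ := exists_dirPair hR hS hS' hx fun i => ⟨k, hk i x⟩
  exact h.equi hR hS ((hRS.nzr (hR.mul hS)).of_mul hR hS) hS'

theorem deformable_of_pos_row {M : Matrix ι ι ℝ} (hM : NN M) (h : Prim M) {x : ι}
    (hx : ∀ k, 0 < M x k) : Deformable M := by
  have := equi_of_pos_row (R := M) (S := 1) hM nn_one (by rwa [Matrix.mul_one])
    (by rwa [Matrix.one_mul]) hx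
  rw [Matrix.mul_one] at this
  exact this.1

end FullRow

section Border

variable {ι κ : Type*} [Fintype ι] [DecidableEq ι] [Fintype κ] [DecidableEq κ]

/-- The extension of `A` by one index obtained by splitting off the rank one part `ζ * y`. -/
def border (A : Matrix ι ι ℝ) (ζ : Matrix ι Unit ℝ) (y : Matrix Unit ι ℝ) :
    Matrix (ι ⊕ Unit) (ι ⊕ Unit) ℝ :=
  Matrix.fromBlocks (A - ζ * y) ζ (y * (A - ζ * y)) (y * ζ)

/-- `R - ζ * θ` with the additional column `ζ`. -/
abbrev cutCols (R : Matrix ι κ ℝ) (ζ : Matrix ι Unit ℝ) (θ : Matrix Unit κ ℝ) :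
    Matrix ι (κ ⊕ Unit) ℝ :=
  Matrix.fromCols (R - ζ * θ) ζ

/-- The identity with the additional row `y`. -/
abbrev addRow (y : Matrix Unit ι ℝ) : Matrix (ι ⊕ Unit) ι ℝ := Matrix.fromRows 1 y

/-- `S` with an additional diagonal entry `1`. -/
abbrev addLoop (S : Matrix κ ι ℝ) : Matrix (κ ⊕ Unit) (ι ⊕ Unit) ℝ := Matrix.fromBlocks S 0 0 1

theorem border_eq (A : Matrix ι ι ℝ) (ζ : Matrix ι Unit ℝ) (y : Matrix Unit ι ℝ) :
    border A ζ y = addRow y * cutCols A ζ y := by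
  rw [Matrix.fromRows_mul_fromCols, Matrix.one_mul, Matrix.one_mul, border]

theorem fromCols_mul_fromRows_eq (A : Matrix ι κ ℝ) (ζ : Matrix ι Unit ℝ) (y : Matrix Unit κ ℝ) :
    cutCols A ζ y * addRow y = A := by
  rw [Matrix.fromCols_mul_fromRows, Matrix.mul_one, sub_add_cancel]

/-- Subtracting `ζ * θ` from `R` leaves a nonnegative matrix with the same support. -/
def StrictSlack (R : Matrix ι κ ℝ) (ζ : Matrix ι Unit ℝ) (θ : Matrix Unit κ ℝ) : Prop :=
  NN (R - ζ * θ) ∧ ∀ i k, 0 < R i k → 0 < (R - ζ * θ) i k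

theorem mul_unit_apply (ζ : Matrix ι Unit ℝ) (θ : Matrix Unit κ ℝ) (i : ι) (k : κ) :
    (ζ * θ) i k = ζ i () * θ () k := by
  simp [Matrix.mul_apply]

theorem StrictSlack.mul_right {μ : Type*} {R : Matrix ι κ ℝ} {S : Matrix κ μ ℝ}
    {ζ : Matrix ι Unit ℝ} {θ : Matrix Unit κ ℝ} (h : StrictSlack R ζ θ) (hR : NN R) (hS : NN S) :
    StrictSlack (R * S) ζ (θ * S) := by
  have e : R * S - ζ * (θ * S) = (R - ζ * θ) * S := by rw [Matrix.sub_mul, Matrix.mul_assoc]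
  rw [StrictSlack, e]
  refine ⟨h.1.mul hS, fun i k hik => ?_⟩
  obtain ⟨j, h₁, h₂⟩ := exists_of_mul_apply_pos hR hS hik
  exact mul_apply_pos h.1 hS (h.2 i j h₁) h₂

theorem StrictSlack.mul_left {μ : Type*} {R : Matrix ι κ ℝ} {S : Matrix μ ι ℝ}
    {ζ : Matrix ι Unit ℝ} {θ : Matrix Unit κ ℝ} (h : StrictSlack R ζ θ) (hR : NN R) (hS : NN S) :
    StrictSlack (S * R) (S * ζ) θ := by
  have e : S * R - S * ζ * θ = S * (R - ζ * θ) := by rw [Matrix.mul_sub, Matrix.mul_assoc]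
  rw [StrictSlack, e]
  refine ⟨hS.mul h.1, fun i k hik => ?_⟩
  obtain ⟨j, h₁, h₂⟩ := exists_of_mul_apply_pos hS hR hik
  exact mul_apply_pos hS h.1 h₁ (h.2 j k h₂)

theorem eventually_strictSlack {R : Matrix ι κ ℝ} {ζ : Matrix ι Unit ℝ} {θ : Matrix Unit κ ℝ}
    (hR : NN R) (h : ∀ i k, R i k = 0 → ζ i () * θ () k = 0) :
    ∀ᶠ t : ℝ in 𝓝[>] 0, StrictSlack R (t • ζ) θ := by
  have : ∀ᶠ t : ℝ in 𝓝[>] 0, ∀ i k, 0 < R i k → 0 < (R - (t • ζ) * θ) i k := by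
    simp only [eventually_all]
    intro i k hik
    have hc : Continuous fun t : ℝ => R i k - t * ζ i () * θ () k := by fun_prop
    have := (hc.tendsto 0).eventually (lt_mem_nhds (by simpa using hik))
    filter_upwards [this.filter_mono nhdsWithin_le_nhds] with t ht
    rw [Matrix.sub_apply, mul_unit_apply, Matrix.smul_apply, smul_eq_mul]
    exact ht
  filter_upwards [this] with t ht
  refine ⟨fun i k => ?_, ht⟩
  rcases (hR i k).eq_or_lt with h0 | h0
  · rw [Matrix.sub_apply, mul_unit_apply, Matrix.smul_apply, smul_eq_mul, mul_assoc,
      h i k h0.symm, ← h0]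
    simp
  · exact (ht i k h0).le

theorem nn_fromRows {μ : Type*} {M : Matrix ι μ ℝ} {N : Matrix κ μ ℝ} (hM : NN M) (hN : NN N) :
    NN (Matrix.fromRows M N) := by
  rintro (i | i) j
  · exact hM i j
  · exact hN i j

theorem nn_fromCols {μ : Type*} {M : Matrix μ ι ℝ} {N : Matrix μ κ ℝ} (hM : NN M) (hN : NN N) :
    NN (Matrix.fromCols M N) := by
  rintro i (j | j)
  · exact hM i j
  · exact hN i j

theorem nzr_fromRows_one {y : Matrix Unit ι ℝ} (h : ∃ j, 0 < y () j) :
    NZR (addRow y) := by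
  rintro (i | ⟨⟩)
  · exact ⟨i, by simp⟩
  · exact h

theorem StrictSlack.nzr_fromCols {R : Matrix ι κ ℝ} {ζ : Matrix ι Unit ℝ} {θ : Matrix Unit κ ℝ}
    (h : StrictSlack R ζ θ) (hR : NZR R) : NZR (cutCols R ζ θ) := fun i => by
  obtain ⟨k, hk⟩ := hR i
  exact ⟨.inl k, h.2 i k hk⟩

theorem StrictSlack.nzc_fromCols {R : Matrix ι κ ℝ} {ζ : Matrix ι Unit ℝ} {θ : Matrix Unit κ ℝ}
    (h : StrictSlack R ζ θ) (hR : NZC R) (hζ : ∃ i, 0 < ζ i ()) :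
    NZC (cutCols R ζ θ) := by
  rintro (k | ⟨⟩)
  · obtain ⟨i, hi⟩ := hR k
    exact ⟨i, h.2 i k hi⟩
  · exact hζ

theorem StrictSlack.nzr_border {A : Matrix ι ι ℝ} {ζ : Matrix ι Unit ℝ} {y : Matrix Unit ι ℝ}
    (h : StrictSlack A ζ y) (hζ : NN ζ) (hy : NN y) (hA : NZR A) (hy' : ∃ j, 0 < y () j) :
    NZR (border A ζ y) := by
  rw [border_eq]
  exact NZR.mul (nn_fromRows nn_one hy) (nn_fromCols h.1 hζ) (nzr_fromRows_one hy')
    (h.nzr_fromCols hA)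

theorem StrictSlack.prim_border {A : Matrix ι ι ℝ} {ζ : Matrix ι Unit ℝ} {y : Matrix Unit ι ℝ}
    (h : StrictSlack A ζ y) (hζ : NN ζ) (hy : NN y) (hA : NN A) (hA' : Prim A)
    (hζ' : ∃ i, 0 < ζ i ()) (hy' : ∃ j, 0 < y () j) : Prim (border A ζ y) := by
  rw [border_eq]
  refine Prim.swap ?_ (nn_fromCols h.1 hζ) (nn_fromRows nn_one hy)
    (h.nzc_fromCols (hA'.nzc hA) hζ') (nzr_fromRows_one hy')
  rwa [fromCols_mul_fromRows_eq]

/-- Splitting off a small rank one part does not leave the class of a deformable matrix. -/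
theorem Deformable.equi_border {A : Matrix ι ι ℝ} (hA : Deformable A) (hA' : NZR A)
    {ζ : Matrix ι Unit ℝ} {y : Matrix Unit ι ℝ} (hζ : NN ζ) (hy : NN y) (hy' : ∃ j, 0 < y () j)
    (h : ∀ i j, A i j = 0 → ζ i () * y () j = 0) :
    ∀ᶠ t : ℝ in 𝓝[>] 0, Equi A (border A (t • ζ) y) := by
  obtain ⟨hN, X, hX⟩ := hA
  obtain ⟨σ', hσ'0, hσ'⟩ : ∃ σ' : ℝ, 0 < σ' ∧
      ∀ i j, A i j = 0 → 0 < (A * X - X * A) i j - σ' * ∑ k, A i k := by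
    have : ∀ᶠ s : ℝ in 𝓝[>] 0, ∀ i j, A i j = 0 → 0 < (A * X - X * A) i j - s * ∑ k, A i k := by
      simp only [eventually_all]
      intro i j h0
      have hc : Continuous fun s : ℝ => (A * X - X * A) i j - s * ∑ k, A i k := by fun_prop
      exact ((hc.tendsto 0).eventually (lt_mem_nhds (by simpa using hX i j h0))).filter_mono
        nhdsWithin_le_nhds
    obtain ⟨s, h₁, h₂⟩ := (this.and self_mem_nhdsWithin).exists
    exact ⟨s, h₂, h₁⟩
  obtain ⟨σ, hσ0, hσ⟩ : ∃ σ : ℝ, 0 < σ ∧ ∀ j, σ * y () j < σ' := by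
    have : ∀ᶠ s : ℝ in 𝓝[>] 0, ∀ j, s * y () j < σ' := by
      simp only [eventually_all]
      intro j
      have hc : Continuous fun s : ℝ => s * y () j := by fun_prop
      exact ((hc.tendsto 0).eventually (gt_mem_nhds (by simpa using hσ'0))).filter_mono
        nhdsWithin_le_nhds
    obtain ⟨s, h₁, h₂⟩ := (this.and self_mem_nhdsWithin).exists
    exact ⟨s, h₂, h₁⟩
  obtain ⟨b, hb⟩ : ∃ b : ℝ, ∀ j, -b < (y * X) () j := by
    have : ∀ᶠ b : ℝ in atBot, ∀ j, b < (y * X) () j := by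
      simp only [eventually_all]
      exact fun j => eventually_lt_atBot _
    obtain ⟨b, hb⟩ := this.exists
    exact ⟨-b, by simpa using hb⟩
  let X' : Matrix (ι ⊕ Unit) (ι ⊕ Unit) ℝ := Matrix.fromBlocks
    (X - Matrix.of fun _ _ => σ') (Matrix.of fun _ _ => σ) (Matrix.of fun _ _ => -b) 0
  let Q : ℝ → Matrix ι (ι ⊕ Unit) ℝ := fun t => cutCols A (t • ζ) y
  have hQc : ∀ i k, Continuous fun t => (Q t * X' - X * Q t) i k := by
    intro i k
    have hc : Continuous Q := by
      have : Q = fun t => Matrix.fromCols A 0 + t • Matrix.fromCols (-(ζ * y)) ζ := by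
        ext t i (j | j) <;> simp [Q, sub_eq_add_neg]
      rw [this]
      fun_prop
    exact ((hc.matrix_mul continuous_const).sub (continuous_const.matrix_mul hc)).matrix_elem i k
  have hQ0 : Q 0 = Matrix.fromCols A 0 := by simp [Q, cutCols]
  have hQX : Q 0 * X' - X * Q 0 = Matrix.fromCols
      (A * X - X * A - A * (Matrix.of fun _ _ => σ' : Matrix ι ι ℝ))
      (A * (Matrix.of fun _ _ => σ : Matrix ι Unit ℝ)) := by
    rw [hQ0, Matrix.fromCols_mul_fromBlocks, Matrix.mul_fromCols]
    ext i (j | j) <;> simp [Matrix.mul_sub, sub_right_comm]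
  have hdir : ∀ᶠ t : ℝ in 𝓝[>] 0, ∀ i k, Q t i k = 0 → 0 < (Q t * X' - X * Q t) i k := by
    have slack := eventually_strictSlack (R := A) (ζ := ζ) (θ := y) hN h
    simp only [eventually_all]
    rintro i (j | j)
    · rcases (hN i j).eq_or_lt with h0 | h0
      · have : 0 < (Q 0 * X' - X * Q 0) i (.inl j) := by
          rw [hQX]
          have := hσ' i j h0.symm
          simpa [Matrix.mul_apply, Finset.mul_sum, mul_comm] using this
        filter_upwards [(((hQc i (.inl j)).tendsto 0).eventually (lt_mem_nhds this)).filter_mono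
          nhdsWithin_le_nhds] with t ht _ using ht
      · filter_upwards [slack] with t ht h0'
        exact absurd h0' (ht.2 i j h0).ne'
    · have : 0 < (Q 0 * X' - X * Q 0) i (.inr j) := by
        rw [hQX]
        obtain ⟨k, hk⟩ := hA' i
        have : 0 < ∑ k, A i k * σ := Finset.sum_pos' (fun k _ => mul_nonneg (hN i k) hσ0.le)
          ⟨k, Finset.mem_univ k, mul_pos hk hσ0⟩
        rw [Matrix.fromCols_apply_inr, Matrix.mul_apply]
        exact this
      filter_upwards [(((hQc i (.inr j)).tendsto 0).eventually (lt_mem_nhds this)).filter_mono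
          nhdsWithin_le_nhds] with t ht _ using ht
  have hP : Pos (addRow y * X - X' * addRow y) := by
    have e : addRow y * X - X' * addRow y = Matrix.fromRows
        ((Matrix.of fun _ _ => σ') - (Matrix.of fun _ _ => σ : Matrix ι Unit ℝ) * y)
        (y * X + Matrix.of fun _ _ => b) := by
      rw [Matrix.fromBlocks_mul_fromRows, Matrix.fromRows_mul]
      ext (i | i) j <;> simp
      ring
    rw [e]
    rintro (i | ⟨⟩) j
    · have := hσ j
      simpa [Matrix.mul_apply] using this
    · have := hb j
      simp only [Matrix.fromRows_apply_inr, Matrix.add_apply, Matrix.of_apply]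
      linarith
  filter_upwards [hdir, eventually_strictSlack hN h, self_mem_nhdsWithin] with t ht hs h0
  have hζt : NN (t • ζ) := fun i j => mul_nonneg (le_of_lt h0) (hζ i j)
  have := DirPair.equi (R := Q t) (S := addRow y) (X := X) (X' := X')
    ⟨ht, fun i j _ => hP i j⟩ (nn_fromCols hs.1 hζt) (nn_fromRows nn_one hy)
    (hs.nzr_fromCols hA') (nzr_fromRows_one hy')
  rwa [← border_eq, fromCols_mul_fromRows_eq] at this

/-- The two factors relating the extensions of `R * S` and `S * R`. -/
theorem border_factor (R : Matrix ι κ ℝ) (S : Matrix κ ι ℝ) (ζ : Matrix ι Unit ℝ)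
    (θ : Matrix Unit κ ℝ) :
    addRow (θ * S) * cutCols R ζ θ * addLoop S =
      border (R * S) ζ (θ * S) ∧
    addLoop S * (addRow (θ * S) * cutCols R ζ θ) =
      border (S * R) (S * ζ) θ := by
  have e : addRow (θ * S) * cutCols R ζ θ =
      Matrix.fromBlocks (R - ζ * θ) ζ (θ * S * (R - ζ * θ)) (θ * S * ζ) := by
    rw [Matrix.fromRows_mul_fromCols, Matrix.one_mul, Matrix.one_mul]
  rw [e, Matrix.fromBlocks_multiply, Matrix.fromBlocks_multiply, border, border]
  constructor <;> congr 1 <;> simp [Matrix.mul_sub, Matrix.sub_mul, Matrix.mul_assoc]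

/-- The rows of the first factor multiplied by powers of the extension. -/
theorem border_pow_mul (R : Matrix ι κ ℝ) (S : Matrix κ ι ℝ) (ζ : Matrix ι Unit ℝ)
    (θ : Matrix Unit κ ℝ) (L : ℕ) :
    border (R * S) ζ (θ * S) ^ L *
        (addRow (θ * S) * cutCols R ζ θ) =
      Matrix.fromRows ((R * S) ^ L * cutCols R ζ θ)
        (θ * S * (R * S) ^ L * cutCols R ζ θ) := by
  rw [border_eq, ← Matrix.mul_assoc, mul_pow_mul, fromCols_mul_fromRows_eq, Matrix.fromRows_mul,
    Matrix.fromRows_mul, Matrix.one_mul]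

end Border

section Pointed

variable {ι κ : Type} [Fintype ι] [DecidableEq ι] [Fintype κ] [DecidableEq κ]

/-- The indicator column of an index. -/
def ec (x : ι) : Matrix ι Unit ℝ := Matrix.of fun i _ => if i = x then 1 else 0

/-- The indicator row of an index. -/
def er (x : ι) : Matrix Unit ι ℝ := Matrix.of fun _ i => if i = x then 1 else 0

theorem ec_self (x : ι) : ec x x () = 1 := by simp [ec]

theorem nn_ec (x : ι) : NN (ec x) := fun i _ => by
  simp only [ec, Matrix.of_apply]; split_ifs <;> norm_num

theorem nn_er (x : ι) : NN (er x) := fun _ i => by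
  simp only [er, Matrix.of_apply]; split_ifs <;> norm_num

theorem er_mul_apply {μ : Type} (x : ι) (M : Matrix ι μ ℝ) (j : μ) : (er x * M) () j = M x j := by
  simp [er, Matrix.mul_apply]

theorem mul_ec_apply {μ : Type} (x : ι) (M : Matrix μ ι ℝ) (j : μ) : (M * ec x) j () = M j x := by
  simp [ec, Matrix.mul_apply]

/-- The extension of `A` splitting off a part of the row `x`. -/
noncomputable def grow (t : ℝ) (A : Matrix ι ι ℝ) (x : ι) : Matrix (ι ⊕ Unit) (ι ⊕ Unit) ℝ :=
  border A (t • ec x) (er x * A)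

theorem strictSlack_row {R : Matrix ι κ ℝ} (hR : NN R) (x : ι) {t : ℝ} (ht : t < 1) :
    StrictSlack R (t • ec x) (er x * R) := by
  have e : ∀ i k, (R - (t • ec x) * (er x * R)) i k = if i = x then (1 - t) * R i k else R i k := by
    intro i k
    rw [Matrix.sub_apply, mul_unit_apply, er_mul_apply, Matrix.smul_apply, smul_eq_mul]
    by_cases hi : i = x
    · subst hi
      simp [ec_self]
      ring
    · simp [ec, hi]
  have ht' : 0 < 1 - t := sub_pos.2 ht
  refine ⟨fun i k => ?_, fun i k hik => ?_⟩
  · rw [e]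
    split_ifs
    · exact mul_nonneg ht'.le (hR i k)
    · exact hR i k
  · rw [e]
    split_ifs
    · exact mul_pos ht' hik
    · exact hik

theorem nn_smul {t : ℝ} (ht : 0 < t) {M : Matrix ι κ ℝ} (hM : NN M) : NN (t • M) :=
  fun i j => mul_nonneg ht.le (hM i j)

theorem exists_smul_ec_pos {t : ℝ} (ht : 0 < t) (x : ι) : ∃ i, 0 < (t • ec x) i () :=
  ⟨x, by rw [Matrix.smul_apply, ec_self]; simpa using ht⟩

theorem exists_er_mul_pos {A : Matrix ι ι ℝ} (hA : NZR A) (x : ι) :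
    ∃ j, 0 < (er x * A) () j := by
  simpa only [er_mul_apply] using hA x

theorem nzr_grow {A : Matrix ι ι ℝ} (hA : NN A) (hA' : NZR A) (x : ι) {t : ℝ} (h0 : 0 < t)
    (h1 : t < 1) : NZR (grow t A x) :=
  (strictSlack_row hA x h1).nzr_border (nn_smul h0 (nn_ec x)) ((nn_er x).mul hA) hA'
    (exists_er_mul_pos hA' x)

theorem prim_grow {A : Matrix ι ι ℝ} (hA : NN A) (hA' : Prim A) (x : ι) {t : ℝ} (h0 : 0 < t)
    (h1 : t < 1) : Prim (grow t A x) :=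
  (strictSlack_row hA x h1).prim_border (nn_smul h0 (nn_ec x)) ((nn_er x).mul hA) hA hA'
    (exists_smul_ec_pos h0 x) (exists_er_mul_pos (hA'.nzr hA) x)

theorem eventually_Ioo : ∀ᶠ t : ℝ in 𝓝[>] 0, 0 < t ∧ t < 1 :=
  Ioo_mem_nhdsGT one_pos

theorem Deformable.equi_grow {A : Matrix ι ι ℝ} (hA : Deformable A) (hA' : NZR A) (x : ι) :
    ∀ᶠ t : ℝ in 𝓝[>] 0, Equi A (grow t A x) := by
  refine hA.equi_border hA' (nn_ec x) ((nn_er x).mul hA.1) (exists_er_mul_pos hA' x)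
    fun i j h0 => ?_
  rw [er_mul_apply]
  by_cases hi : i = x
  · rw [← hi, h0, mul_zero]
  · simp [ec, hi]

/-- Equivalence of pointed matrices after growing them `L` times with small parameters. -/
def Rel : ℕ → ∀ {ι κ : Type} [Fintype ι] [DecidableEq ι] [Fintype κ] [DecidableEq κ],
    Matrix ι ι ℝ → ι → Matrix κ κ ℝ → κ → Prop
  | 0, _, _, _, _, _, _, A, _, B, _ => Equi A B
  | L + 1, _, _, _, _, _, _, A, x, B, x' =>
    ∀ᶠ t : ℝ in 𝓝[>] 0, Rel L (grow t A x) (Sum.inr ()) (grow t B x') (Sum.inr ())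

theorem Rel.symm {L : ℕ} : ∀ {ι κ : Type} [Fintype ι] [DecidableEq ι] [Fintype κ] [DecidableEq κ]
    {A : Matrix ι ι ℝ} {x : ι} {B : Matrix κ κ ℝ} {x' : κ}, Rel L A x B x' → Rel L B x' A x := by
  induction L with
  | zero => intro _ _ _ _ _ _ A x B x' h; exact Equi.symm h
  | succ L ih => intro _ _ _ _ _ _ A x B x' h; exact Eventually.mono h fun t ht => ih ht

theorem Rel.trans {L : ℕ} : ∀ {ι κ μ : Type} [Fintype ι] [DecidableEq ι] [Fintype κ]
    [DecidableEq κ] [Fintype μ] [DecidableEq μ]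
    {A : Matrix ι ι ℝ} {x : ι} {B : Matrix κ κ ℝ} {x' : κ} {C : Matrix μ μ ℝ} {x'' : μ},
    Rel L A x B x' → Rel L B x' C x'' → Rel L A x C x'' := by
  induction L with
  | zero => intro _ _ _ _ _ _ _ _ _ A x B x' C x'' h h'; exact Equi.trans h h'
  | succ L ih =>
    intro _ _ _ _ _ _ _ _ _ A x B x' C x'' h h'
    filter_upwards [h, h'] with t h₁ h₂ using ih h₁ h₂

theorem Equi.rel {L : ℕ} : ∀ {ι κ : Type} [Fintype ι] [DecidableEq ι] [Fintype κ] [DecidableEq κ]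
    {A : Matrix ι ι ℝ} {B : Matrix κ κ ℝ} (x : ι) (x' : κ), Equi A B → NZR A → NZR B →
    Rel L A x B x' := by
  induction L with
  | zero => intro _ _ _ _ _ _ A B x x' h _ _; exact h
  | succ L ih =>
    intro _ _ _ _ _ _ A B x x' h hA hB
    change ∀ᶠ t : ℝ in 𝓝[>] 0, _
    filter_upwards [eventually_Ioo, h.1.equi_grow hA x, h.2.1.equi_grow hB x'] with t ht h₁ h₂
    exact ih _ _ ((h₁.symm.trans h).trans h₂) (nzr_grow h.1.1 hA x ht.1 ht.2)
      (nzr_grow h.2.1.1 hB x' ht.1 ht.2)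

theorem Rel.equi {L : ℕ} : ∀ {ι κ : Type} [Fintype ι] [DecidableEq ι] [Fintype κ] [DecidableEq κ]
    {A : Matrix ι ι ℝ} {B : Matrix κ κ ℝ} {x : ι} {x' : κ}, Rel L A x B x' → Deformable A →
    Deformable B → NZR A → NZR B → Equi A B := by
  induction L with
  | zero => intro _ _ _ _ _ _ A B x x' h _ _ _ _; exact h
  | succ L ih =>
    intro _ _ _ _ _ _ A B x x' h dA dB hA hB
    obtain ⟨t, ht, h₁, h₂, h₃⟩ := (eventually_Ioo.and ((dA.equi_grow hA x).and
      ((dB.equi_grow hB x').and h))).exists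
    exact (h₁.trans (ih h₃ h₁.2.1 h₂.2.1 (nzr_grow dA.1 hA x ht.1 ht.2)
      (nzr_grow dB.1 hB x' ht.1 ht.2))).trans h₂.symm

theorem pow_diag_pos {A : Matrix ι ι ℝ} (hA : NN A) {x : ι} (hx : 0 < A x x) (k : ℕ) :
    0 < (A ^ k) x x := by
  induction k with
  | zero => simp
  | succ k ih => rw [pow_succ]; exact mul_apply_pos (hA.pow k) hA ih hx

/-- The pointed version of an elementary equivalence. -/
theorem rel_mul_comm {L : ℕ} : ∀ {ι κ : Type} [Fintype ι] [DecidableEq ι] [Fintype κ]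
    [DecidableEq κ] {R : Matrix ι κ ℝ} {S : Matrix κ ι ℝ} {x : ι} {x' : κ}, NN R → NN S →
    S * ec x = ec x' → er x' * S = er x → 0 < (R * S) x x → Prim (R * S) → Prim (S * R) →
    (∀ k, 0 < ((R * S) ^ L * R : Matrix ι κ ℝ) x k) → Rel L (R * S) x (S * R) x' := by
  induction L with
  | zero =>
    intro _ _ _ _ _ _ R S x x' hR hS _ _ _ p₁ p₂ h
    simp only [pow_zero, Matrix.one_mul] at h
    exact equi_of_pos_row hR hS p₁ p₂ h
  | succ L ih =>
    intro ι κ _ _ _ _ R S x x' hR hS hx hx' hl p₁ p₂ h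
    change ∀ᶠ t : ℝ in 𝓝[>] 0, _
    filter_upwards [eventually_Ioo] with t ht
    have slack := strictSlack_row hR x ht.2
    have nnA := hR.mul hS
    obtain ⟨e₁, e₂⟩ := border_factor R S (t • ec x) (er x * R)
    have g₁ : border (R * S) (t • ec x) (er x * R * S) = grow t (R * S) x := by
      rw [grow, Matrix.mul_assoc]
    have g₂ : border (S * R) (S * (t • ec x)) (er x * R) = grow t (S * R) x' := by
      rw [grow, Matrix.mul_smul, hx, ← Matrix.mul_assoc, hx']
    rw [g₁] at e₁
    rw [g₂] at e₂
    have nR : NN (addRow (er x * R * S) * cutCols R (t • ec x) (er x * R)) :=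
      (nn_fromRows nn_one (((nn_er x).mul hR).mul hS)).mul
        (nn_fromCols slack.1 (nn_smul ht.1 (nn_ec x)))
    have nS : NN (addLoop S) := by
      rintro (i | i) (j | j)
      · exact hS i j
      · exact le_rfl
      · exact le_rfl
      · exact nn_one i j
    have := ih (R := addRow (er x * R * S) * cutCols R (t • ec x) (er x * R)) (S := addLoop S)
      (x := Sum.inr ()) (x' := Sum.inr ()) nR nS ?_ ?_ ?_ ?_ ?_ ?_
    · rwa [e₁, e₂] at this
    · ext (i | i) j
      · rw [mul_ec_apply]; simp [ec]
      · rw [mul_ec_apply]; simp [ec]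
    · ext i (j | j)
      · rw [er_mul_apply]; simp [er]
      · rw [er_mul_apply]; simp [er]
    · rw [e₁, grow, border, Matrix.fromBlocks_apply₂₂, Matrix.mul_smul, Matrix.smul_apply,
        mul_ec_apply, er_mul_apply]
      exact mul_pos ht.1 hl
    · rw [e₁]; exact prim_grow nnA p₁ x ht.1 ht.2
    · rw [e₂]; exact prim_grow (hS.mul hR) p₂ x' ht.1 ht.2
    · rw [e₁, ← g₁, border_pow_mul, Matrix.mul_assoc (er x), Matrix.mul_assoc (er x), ← pow_succ',
        Matrix.mul_assoc (er x)]
      intro k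
      rw [Matrix.fromRows_apply_inr, er_mul_apply]
      rcases k with k | ⟨⟩
      · obtain ⟨j, h₁, h₂⟩ := exists_of_mul_apply_pos (nnA.pow _) hR (h k)
        exact mul_apply_pos (nnA.pow _) (nn_fromCols slack.1 (nn_smul ht.1 (nn_ec x))) h₁
          (j := Sum.inl k) (slack.2 j k h₂)
      · refine mul_apply_pos (nnA.pow _) (nn_fromCols slack.1 (nn_smul ht.1 (nn_ec x)))
          (pow_diag_pos nnA hl _) (j := Sum.inr ()) ?_
        simpa [cutCols, ec] using ht.1

end Pointed

section Invariant

variable {ι κ μ : Type} [Fintype ι] [DecidableEq ι] [Fintype κ] [DecidableEq κ] [Fintype μ]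
  [DecidableEq μ]

/-- The pair `(ζ, y)` can be used to border `A` in such a way that the new index carries a loop. -/
structure Valid (A : Matrix ι ι ℝ) (ζ : Matrix ι Unit ℝ) (y : Matrix Unit ι ℝ) : Prop where
  nn_col : NN ζ
  nn_row : NN y
  supp : ∀ i j, A i j = 0 → ζ i () * y () j = 0
  loop : 0 < (y * ζ) () ()

theorem Valid.exists_both {A : Matrix ι ι ℝ} {ζ : Matrix ι Unit ℝ} {y : Matrix Unit ι ℝ}
    (h : Valid A ζ y) : ∃ i, 0 < y () i ∧ 0 < ζ i () :=
  exists_of_mul_apply_pos h.nn_row h.nn_col h.loop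

theorem valid_ec_er {A : Matrix ι ι ℝ} {p : ι} (h : 0 < A p p) : Valid A (ec p) (er p) where
  nn_col := nn_ec p
  nn_row := nn_er p
  supp i j hij := by
    by_cases hi : i = p
    · by_cases hj : j = p
      · subst hi hj; exact absurd hij h.ne'
      · simp [er, hj]
    · simp [ec, hi]
  loop := by rw [er_mul_apply, ec_self]; exact one_pos

/-- Equivalence, for small parameters, of the pointed matrices obtained by bordering. -/
def RelX (L : ℕ) (A : Matrix ι ι ℝ) (ζ : Matrix ι Unit ℝ) (y : Matrix Unit ι ℝ)
    (B : Matrix κ κ ℝ) (ζ' : Matrix κ Unit ℝ) (y' : Matrix Unit κ ℝ) : Prop :=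
  ∀ᶠ t : ℝ in 𝓝[>] 0,
    Rel L (border A (t • ζ) y) (Sum.inr ()) (border B (t • ζ') y') (Sum.inr ())

theorem RelX.symm {L : ℕ} {A : Matrix ι ι ℝ} {ζ : Matrix ι Unit ℝ} {y : Matrix Unit ι ℝ}
    {B : Matrix κ κ ℝ} {ζ' : Matrix κ Unit ℝ} {y' : Matrix Unit κ ℝ}
    (h : RelX L A ζ y B ζ' y') : RelX L B ζ' y' A ζ y :=
  Eventually.mono h fun _ ht => ht.symm

theorem RelX.trans {L : ℕ} {A : Matrix ι ι ℝ} {ζ : Matrix ι Unit ℝ} {y : Matrix Unit ι ℝ}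
    {B : Matrix κ κ ℝ} {ζ' : Matrix κ Unit ℝ} {y' : Matrix Unit κ ℝ}
    {C : Matrix μ μ ℝ} {ζ'' : Matrix μ Unit ℝ} {y'' : Matrix Unit μ ℝ}
    (h : RelX L A ζ y B ζ' y') (h' : RelX L B ζ' y' C ζ'' y'') : RelX L A ζ y C ζ'' y'' := by
  filter_upwards [h, h'] with t h₁ h₂ using h₁.trans h₂

theorem valid_mul_comm {R : Matrix ι κ ℝ} {S : Matrix κ ι ℝ} {ζ : Matrix ι Unit ℝ}
    {θ : Matrix Unit κ ℝ} (hR : NN R) (hS : NN S) (hζ : NN ζ) (hθ : NN θ)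
    (h : ∀ i k, R i k = 0 → ζ i () * θ () k = 0) (hl : 0 < (θ * S * ζ) () ()) :
    Valid (R * S) ζ (θ * S) ∧ Valid (S * R) (S * ζ) θ := by
  obtain ⟨t, ht, hs⟩ := (eventually_Ioo.and (eventually_strictSlack hR h)).exists
  have key : ∀ {ν : Type} {M : Matrix ν ν ℝ} {ξ : Matrix ν Unit ℝ} {y : Matrix Unit ν ℝ}, NN ξ →
      NN y → StrictSlack M (t • ξ) y → ∀ i j, M i j = 0 → ξ i () * y () j = 0 := by
    intro ν M ξ y hξ hy hs i j hij
    have h₁ := hs.1 i j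
    have h₂ : ((t • ξ) * y) i j = t * ξ i () * y () j := by simp [Matrix.mul_apply]
    rw [Matrix.sub_apply, hij, h₂] at h₁
    have h₃ := mul_nonneg (hξ i ()) (hy () j)
    nlinarith [ht.1]
  refine ⟨⟨hζ, hθ.mul hS, key hζ (hθ.mul hS) (hs.mul_right hR hS), hl⟩,
    ⟨hS.mul hζ, hθ, key (hS.mul hζ) hθ ?_, ?_⟩⟩
  · rw [← Matrix.mul_smul]; exact hs.mul_left hR hS
  · rwa [← Matrix.mul_assoc]

theorem relX_mul_comm {L : ℕ} {R : Matrix ι κ ℝ} {S : Matrix κ ι ℝ} {ζ : Matrix ι Unit ℝ}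
    {θ : Matrix Unit κ ℝ} (hR : NN R) (hS : NN S) (p₁ : Prim (R * S)) (p₂ : Prim (S * R))
    (hζ : NN ζ) (hθ : NN θ) (h : ∀ i k, R i k = 0 → ζ i () * θ () k = 0)
    (hl : 0 < (θ * S * ζ) () ()) (hL : Pos ((R * S) ^ L)) :
    RelX L (R * S) ζ (θ * S) (S * R) (S * ζ) θ := by
  obtain ⟨i₀, hy₀, hζ₀⟩ := exists_of_mul_apply_pos (hθ.mul hS) hζ hl
  obtain ⟨k₀, hθ₀, hS₀⟩ := exists_of_mul_apply_pos hθ hS hy₀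
  have nnA := hR.mul hS
  have hRc : NZC R := (p₂.nzc (hS.mul hR)).of_mul hS hR
  filter_upwards [eventually_Ioo, eventually_strictSlack hR h] with t ht slack
  have hζt := nn_smul ht.1 hζ
  have hζt₀ : 0 < (t • ζ) i₀ () := mul_pos ht.1 hζ₀
  obtain ⟨e₁, e₂⟩ := border_factor R S (t • ζ) θ
  have nS : NN (addLoop S) := by
    rintro (i | i) (j | j)
    · exact hS i j
    · exact le_rfl
    · exact le_rfl
    · exact nn_one i j
  have nR : NN (addRow (θ * S) * cutCols R (t • ζ) θ) :=
    (nn_fromRows nn_one (hθ.mul hS)).mul (nn_fromCols slack.1 hζt)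
  have := rel_mul_comm (L := L) (R := addRow (θ * S) * cutCols R (t • ζ) θ) (S := addLoop S)
    (x := Sum.inr ()) (x' := Sum.inr ()) nR nS ?_ ?_ ?_ ?_ ?_ ?_
  · rwa [e₁, e₂, Matrix.mul_smul] at this
  · ext (i | i) j
    · rw [mul_ec_apply]; simp [ec]
    · rw [mul_ec_apply]; simp [ec]
  · ext i (j | j)
    · rw [er_mul_apply]; simp [er]
    · rw [er_mul_apply]; simp [er]
  · rw [e₁, border, Matrix.fromBlocks_apply₂₂]
    exact mul_apply_pos (hθ.mul hS) hζt hy₀ hζt₀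
  · rw [e₁]
    exact (slack.mul_right hR hS).prim_border hζt (hθ.mul hS) nnA p₁ ⟨i₀, hζt₀⟩ ⟨i₀, hy₀⟩
  · rw [e₂]
    exact (slack.mul_left hR hS).prim_border (hS.mul hζt) hθ (hS.mul hR) p₂
      ⟨k₀, mul_apply_pos hS hζt hS₀ hζt₀⟩ ⟨k₀, hθ₀⟩
  · rw [e₁, border_pow_mul]
    intro k
    rw [Matrix.fromRows_apply_inr]
    obtain ⟨i, hi⟩ := slack.nzc_fromCols hRc ⟨i₀, hζt₀⟩ k
    exact mul_apply_pos ((hθ.mul hS).mul (nnA.pow _)) (nn_fromCols slack.1 hζt)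
      (mul_apply_pos (hθ.mul hS) (nnA.pow _) hy₀ (hL i₀ i)) hi

/-- The result of bordering at level `L` does not depend on the bordering pairs. -/
def InvRel (L : ℕ) (A : Matrix ι ι ℝ) (B : Matrix κ κ ℝ) : Prop :=
  ∀ ζ y, Valid A ζ y → ∀ ζ' y', Valid B ζ' y' → RelX L A ζ y B ζ' y'

theorem InvRel.trans {L : ℕ} {A : Matrix ι ι ℝ} {B : Matrix κ κ ℝ} {C : Matrix μ μ ℝ}
    (h : InvRel L A B) (h' : InvRel L B C) {p : κ} (hp : 0 < B p p) : InvRel L A C :=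
  fun ζ y v ζ'' y'' v'' =>
    (h ζ y v _ _ (valid_ec_er hp)).trans (h' _ _ (valid_ec_er hp) ζ'' y'' v'')

theorem eventually_invRel_self_aux (m : ℕ) : ∀ {ι : Type} [Fintype ι] [DecidableEq ι]
    {M : Matrix ι ι ℝ} {p : ι}, NN M → Prim M → 0 < M p p → (∀ j, 0 < (M ^ (m + 1)) p j) →
    ∀ᶠ L in atTop, InvRel L M M := by
  induction m with
  | zero =>
    intro ι _ _ M p hM hM' hp h
    simp only [zero_add, pow_one] at h
    have d := deformable_of_pos_row hM hM' h
    have nz := hM'.nzr hM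
    refine Eventually.of_forall fun L ζ y v ζ' y' v' => ?_
    have h₁ := v.exists_both.imp fun _ h => h.1
    have h₂ := v'.exists_both.imp fun _ h => h.1
    filter_upwards [eventually_Ioo, d.equi_border nz v.nn_col v.nn_row h₁ v.supp,
      d.equi_border nz v'.nn_col v'.nn_row h₂ v'.supp, eventually_strictSlack hM v.supp,
      eventually_strictSlack hM v'.supp] with t ht q₁ q₂ s₁ s₂
    exact (q₁.symm.trans q₂).rel _ _
      (s₁.nzr_border (nn_smul ht.1 v.nn_col) v.nn_row nz h₁)
      (s₂.nzr_border (nn_smul ht.1 v'.nn_col) v'.nn_row nz h₂)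
  | succ m ih =>
    intro ι _ _ M p hM hM' hp h
    have h0 : (0 : ℝ) < 1 / 2 := by norm_num
    have h1 : (1 : ℝ) / 2 < 1 := by norm_num
    have slack := strictSlack_row hM p h1
    have hec := nn_smul h0 (nn_ec p)
    have her := (nn_er p).mul hM
    set P : Matrix (ι ⊕ Unit) ι ℝ := addRow (er p * M) with hP
    set Q : Matrix ι (ι ⊕ Unit) ℝ := cutCols M ((1 / 2 : ℝ) • ec p) (er p * M) with hQ
    have nP : NN P := nn_fromRows nn_one her
    have nQ : NN Q := nn_fromCols slack.1 hec
    have eK : P * Q = grow (1 / 2) M p := (border_eq _ _ _).symm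
    have eM : Q * P = M := fromCols_mul_fromRows_eq _ _ _
    have pK : Prim (P * Q) := by rw [eK]; exact prim_grow hM hM' p h0 h1
    have lK : 0 < (P * Q) (Sum.inr ()) (Sum.inr ()) := by
      rw [eK, grow, border, Matrix.fromBlocks_apply₂₂]
      refine mul_apply_pos her hec (j := ()) (k := p) ?_ ?_
      · rwa [er_mul_apply]
      · rw [Matrix.smul_apply, ec_self]; simp
    have hK : ∀ᶠ L in atTop, InvRel L (P * Q) (P * Q) := by
      refine ih (p := Sum.inr ()) (nP.mul nQ) pK lK fun k => ?_
      have nM := hM.pow (m + 1)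
      rw [pow_succ, ← Matrix.mul_assoc, mul_pow_mul, eM, hP, Matrix.fromRows_mul,
        Matrix.fromRows_mul, Matrix.fromRows_apply_inr, Matrix.mul_assoc (er p), ← pow_succ',
        Matrix.mul_assoc (er p), er_mul_apply]
      rcases k with k | ⟨⟩
      · have hk := h k
        rw [pow_succ] at hk
        obtain ⟨j, h₁, h₂⟩ := exists_of_mul_apply_pos nM hM hk
        exact mul_apply_pos nM nQ h₁ (slack.2 j k h₂)
      · refine mul_apply_pos nM nQ (k := p) (pow_diag_pos hM hp _) ?_
        change 0 < ((1 / 2 : ℝ) • ec p) p ()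
        rw [Matrix.smul_apply, ec_self]
        simp
    filter_upwards [hK, hM'] with L hL hpos
    have key : ∀ ζ y, Valid M ζ y → ∃ ξ θ, Valid (P * Q) ξ θ ∧ RelX L M ζ y (P * Q) ξ θ := by
      intro ζ y v
      set θ : Matrix Unit (ι ⊕ Unit) ℝ := Matrix.fromCols y 0 with hθ
      have nθ : NN θ := nn_fromCols v.nn_row fun _ _ => le_rfl
      have eθ : θ * P = y := by
        rw [hθ, hP, Matrix.fromCols_mul_fromRows, Matrix.mul_one, Matrix.zero_mul, add_zero]
      have supp : ∀ i k, Q i k = 0 → ζ i () * θ () k = 0 := by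
        rintro i (k | k) hk
        · refine v.supp i k (le_antisymm (not_lt.1 fun hlt => ?_) (hM i k))
          exact (slack.2 i k hlt).ne' hk
        · simp [hθ]
      have hl : 0 < (θ * P * ζ) () () := by rw [eθ]; exact v.loop
      have := relX_mul_comm (L := L) nQ nP (by rwa [eM]) pK v.nn_col nθ supp hl (by rwa [eM])
      rw [eM, eθ] at this
      exact ⟨_, _, (valid_mul_comm nQ nP v.nn_col nθ supp hl).2, this⟩
    intro ζ y v ζ' y' v'
    obtain ⟨ξ, θ, w, r⟩ := key ζ y v
    obtain ⟨ξ', θ', w', r'⟩ := key ζ' y' v'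
    exact (r.trans (hL _ _ w _ _ w')).trans r'.symm

theorem eventually_invRel_self {M : Matrix ι ι ℝ} {p : ι} (hM : NN M) (hM' : Prim M)
    (hp : 0 < M p p) : ∀ᶠ L in atTop, InvRel L M M := by
  obtain ⟨m, hm⟩ := ((tendsto_add_atTop_nat 1).eventually hM').exists
  exact eventually_invRel_self_aux m hM hM' hp fun j => hm p j

theorem eventually_invRel_mul_comm {R : Matrix ι κ ℝ} {S : Matrix κ ι ℝ} (hR : NN R) (hS : NN S)
    (p₁ : Prim (R * S)) (p₂ : Prim (S * R)) {p : ι} (hp : 0 < (R * S) p p) :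
    ∀ᶠ L in atTop, InvRel L (R * S) (S * R) := by
  obtain ⟨q, hpq, hqp⟩ := exists_of_mul_apply_pos hR hS hp
  have hq : 0 < (S * R) q q := mul_apply_pos hS hR hqp hpq
  have supp : ∀ i k, R i k = 0 → ec p i () * er q () k = 0 := by
    intro i k hik
    by_cases hi : i = p
    · by_cases hk : k = q
      · subst hi hk; exact absurd hik hpq.ne'
      · simp [er, hk]
    · simp [ec, hi]
  have hl : 0 < (er q * S * ec p) () () := by rwa [mul_ec_apply, er_mul_apply]
  obtain ⟨v₁, v₂⟩ := valid_mul_comm hR hS (nn_ec p) (nn_er q) supp hl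
  filter_upwards [eventually_invRel_self (hR.mul hS) p₁ hp,
    eventually_invRel_self (hS.mul hR) p₂ hq, p₁] with L h₁ h₂ hL ζ y v ζ' y' v'
  exact ((h₁ _ _ v _ _ v₁).trans (relX_mul_comm hR hS p₁ p₂ (nn_ec p) (nn_er q) supp hl hL)).trans
    (h₂ _ _ v₂ _ _ v')

end Invariant

section Core

variable {ι κ : Type} [Fintype ι] [DecidableEq ι] [Fintype κ] [DecidableEq κ]

/-- There are arbitrarily long paths starting at `k`. -/
def Alive (M : Matrix ι ι ℝ) (k : ι) : Prop := ∀ n : ℕ, ∃ j, 0 < (M ^ n) k j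

theorem alive_of_pos {R : Matrix ι κ ℝ} {S : Matrix κ ι ℝ} (hR : NN R) (hS : NN S) {j : ι} {l : κ}
    (h : 0 < R j l) (hl : Alive (S * R) l) : Alive (R * S) j := by
  rintro (_ | n)
  · exact ⟨j, by simp⟩
  · obtain ⟨m, hm⟩ := hl (n + 1)
    have nn := (hS.mul hR).pow n
    rw [pow_succ, ← Matrix.mul_assoc] at hm
    obtain ⟨i, hi, -⟩ := exists_of_mul_apply_pos (nn.mul hS) hR hm
    refine ⟨i, ?_⟩
    rw [pow_succ, ← Matrix.mul_assoc, mul_pow_mul, Matrix.mul_assoc]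
    exact mul_apply_pos hR (nn.mul hS) h hi

theorem Alive.exists_pos {R : Matrix ι κ ℝ} {S : Matrix κ ι ℝ} (hR : NN R) (hS : NN S) {j : ι}
    (h : Alive (R * S) j) : ∃ l, 0 < R j l ∧ Alive (S * R) l := by
  by_contra! H
  have nn := hS.mul hR
  have mono : ∀ l n m, n ≤ m → (∃ i, 0 < ((S * R) ^ m : Matrix κ κ ℝ) l i) →
      ∃ i, 0 < ((S * R) ^ n : Matrix κ κ ℝ) l i := by
    rintro l n m hnm ⟨i, hi⟩
    obtain ⟨d, rfl⟩ := Nat.exists_eq_add_of_le hnm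
    rw [pow_add] at hi
    exact (exists_of_mul_apply_pos (nn.pow n) (nn.pow d) hi).imp fun _ h => h.1
  have H' : ∀ l, ∃ n, 0 < R j l → ¬ ∃ i, 0 < ((S * R) ^ n : Matrix κ κ ℝ) l i := by
    intro l
    by_cases hl : 0 < R j l
    · have := H l hl
      rw [Alive, not_forall] at this
      exact this.imp fun _ h _ => h
    · exact ⟨0, fun h => absurd h hl⟩
  choose f hf using H'
  obtain ⟨i, hi⟩ := h (Finset.univ.sup f + 1)
  rw [pow_succ, ← Matrix.mul_assoc, mul_pow_mul, Matrix.mul_assoc] at hi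
  obtain ⟨l, h₁, h₂⟩ := exists_of_mul_apply_pos hR ((nn.pow _).mul hS) hi
  obtain ⟨k, h₃, -⟩ := exists_of_mul_apply_pos (nn.pow _) hS h₂
  exact hf l h₁ (mono l _ _ (Finset.le_sup (Finset.mem_univ l)) ⟨k, h₃⟩)

/-- The indices lying on bi-infinite paths. -/
def IsCore (M : Matrix ι ι ℝ) (k : ι) : Prop := Alive M k ∧ Alive Mᵀ k

/-- The part of `M` carried by bi-infinite paths. -/
def trim (M : Matrix ι ι ℝ) : Matrix {k // IsCore M k} {k // IsCore M k} ℝ :=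
  M.submatrix Subtype.val Subtype.val

theorem NN.transpose {R : Matrix ι κ ℝ} (hR : NN R) : NN Rᵀ := fun i j => hR j i

theorem IsCore.middle {R : Matrix ι κ ℝ} {S : Matrix κ ι ℝ} (hR : NN R) (hS : NN S) {j k : ι}
    {l : κ} (hj : IsCore (R * S) j) (hk : IsCore (R * S) k) (hjl : 0 < R j l) (hlk : 0 < S l k) :
    IsCore (S * R) l := by
  refine ⟨alive_of_pos hS hR hlk hk.1, ?_⟩
  rw [Matrix.transpose_mul]
  refine alive_of_pos (j := l) (l := j) hR.transpose hS.transpose hjl ?_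
  rw [← Matrix.transpose_mul]
  exact hj.2

theorem IsCore.exists_row {R : Matrix ι κ ℝ} {S : Matrix κ ι ℝ} (hR : NN R) (hS : NN S) {l : κ}
    (hl : IsCore (S * R) l) : ∃ k, 0 < S l k ∧ IsCore (R * S) k := by
  obtain ⟨k, h₁, h₂⟩ := hl.1.exists_pos hS hR
  refine ⟨k, h₁, h₂, ?_⟩
  rw [Matrix.transpose_mul]
  refine alive_of_pos (j := k) (l := l) hS.transpose hR.transpose h₁ ?_
  rw [← Matrix.transpose_mul]
  exact hl.2

theorem IsCore.exists_col {R : Matrix ι κ ℝ} {S : Matrix κ ι ℝ} (hR : NN R) (hS : NN S) {l : κ}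
    (hl : IsCore (S * R) l) : ∃ j, 0 < R j l ∧ IsCore (R * S) j := by
  have h := hl.2
  rw [Matrix.transpose_mul] at h
  obtain ⟨j, h₁, h₂⟩ := h.exists_pos hR.transpose hS.transpose
  rw [← Matrix.transpose_mul] at h₂
  exact ⟨j, h₁, alive_of_pos hR hS h₁ hl.1, h₂⟩

/-- The block of `R` joining the cores of `R * S` and `S * R`. -/
def trimFactor (R : Matrix ι κ ℝ) (S : Matrix κ ι ℝ) :
    Matrix {k // IsCore (R * S) k} {k // IsCore (S * R) k} ℝ :=
  R.submatrix Subtype.val Subtype.val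

open scoped Classical in
theorem trimFactor_mul {R : Matrix ι κ ℝ} {S : Matrix κ ι ℝ} (hR : NN R) (hS : NN S) :
    trimFactor R S * trimFactor S R = trim (R * S) := by
  ext ⟨i, hi⟩ ⟨j, hj⟩
  simp only [trim, trimFactor, Matrix.mul_apply, Matrix.submatrix_apply]
  rw [← Finset.sum_subtype (Finset.univ.filter (IsCore (S * R))) (by simp)
    (fun l => R i l * S l j)]
  refine Finset.sum_subset (Finset.subset_univ _) fun l _ hl => ?_
  rcases (hR i l).eq_or_lt with h | h
  · rw [← h, zero_mul]
  rcases (hS l j).eq_or_lt with h' | h'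
  · rw [← h', mul_zero]
  · exact absurd (Finset.mem_filter.2 ⟨Finset.mem_univ l, hi.middle hR hS hj h h'⟩) hl

open scoped Classical in
theorem eventually_invRel_trim {R : Matrix ι κ ℝ} {S : Matrix κ ι ℝ} (hR : NN R) (hS : NN S)
    (p₁ : Prim (trim (R * S))) (hp : ∃ p, 0 < trim (R * S) p p) :
    Prim (trim (S * R)) ∧ (∃ q, 0 < trim (S * R) q q) ∧
      ∀ᶠ L in atTop, InvRel L (trim (R * S)) (trim (S * R)) := by
  obtain ⟨p, hp⟩ := hp
  have nR : NN (trimFactor R S) := fun i j => hR _ _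
  have nS : NN (trimFactor S R) := fun i j => hS _ _
  have e₁ := trimFactor_mul hR hS
  have e₂ := trimFactor_mul hS hR
  rw [← e₁] at p₁ hp
  obtain ⟨q, hpq, hqp⟩ := exists_of_mul_apply_pos nR nS hp
  have p₂ : Prim (trimFactor S R * trimFactor R S) := p₁.swap nR nS
    (fun ⟨l, hl⟩ => let ⟨j, h₁, h₂⟩ := hl.exists_col hR hS; ⟨⟨j, h₂⟩, h₁⟩)
    (fun ⟨l, hl⟩ => let ⟨j, h₁, h₂⟩ := hl.exists_row hR hS; ⟨⟨j, h₂⟩, h₁⟩)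
  rw [← e₁, ← e₂]
  exact ⟨p₂, ⟨q, mul_apply_pos nS nR hqp hpq⟩, eventually_invRel_mul_comm nR nS p₁ p₂ hp⟩

end Core

theorem Pos.prim {ι : Type} [Fintype ι] [DecidableEq ι] {M : Matrix ι ι ℝ} (h : Pos M) :
    Prim M := by
  have nz : NZR M := fun i => ⟨i, h i i⟩
  have : ∀ k : ℕ, Pos (M ^ (k + 1)) := by
    intro k
    induction k with
    | zero => simpa using h
    | succ k ih =>
      rw [pow_succ']
      exact Pos.mul_of_nzr h.nn nz ih
  refine eventually_atTop.2 ⟨1, fun k hk => ?_⟩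
  obtain ⟨l, rfl⟩ : ∃ l, k = l + 1 := ⟨k - 1, by omega⟩
  exact this l

theorem Pos.isCore {ι : Type} [Fintype ι] [DecidableEq ι] {M : Matrix ι ι ℝ} (h : Pos M) (k : ι) :
    IsCore M k := by
  have ht : Pos Mᵀ := fun i j => h j i
  exact ⟨fun n => ⟨k, pow_diag_pos h.nn (h k k) n⟩, fun n => ⟨k, pow_diag_pos ht.nn (ht k k) n⟩⟩

theorem posSSE_of_invRel {ι κ : Type} [Fintype ι] [DecidableEq ι] [Fintype κ] [DecidableEq κ]
    {A : Matrix ι ι ℝ} {B : Matrix κ κ ℝ} (hA : Pos A) (hB : Pos B) {L : ℕ} (p : ι) (q : κ)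
    (h : InvRel L A B) :
    PosSSE (rep A) (rep B) := by
  have vA := valid_ec_er (hA p p)
  have vB := valid_ec_er (hB q q)
  have nA := hA.prim.nzr hA.nn
  have nB := hB.prim.nzr hB.nn
  have yA := vA.exists_both.imp fun _ h => h.1
  have yB := vB.exists_both.imp fun _ h => h.1
  obtain ⟨t, ht, h₁, h₂, s₁, s₂, h₃⟩ := (eventually_Ioo.and
    ((hA.deformable.equi_border nA vA.nn_col vA.nn_row yA vA.supp).and
    ((hB.deformable.equi_border nB vB.nn_col vB.nn_row yB vB.supp).and
    ((eventually_strictSlack hA.nn vA.supp).and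
    ((eventually_strictSlack hB.nn vB.supp).and (h _ _ vA _ _ vB)))))).exists
  refine ((h₁.trans (h₃.equi h₁.2.1 h₂.2.1 ?_ ?_)).trans h₂.symm).posSSE hA hB
  · exact s₁.nzr_border (nn_smul ht.1 vA.nn_col) vA.nn_row nA yA
  · exact s₂.nzr_border (nn_smul ht.1 vB.nn_col) vB.nn_row nB yB

open scoped Classical in
theorem posSSE_rep_trim {n : ℕ} {A : Matrix (Fin n) (Fin n) ℝ} (hA : PosEntries A) :
    PosSSE ⟨n, A⟩ (rep (trim A)) :=
  posSSE_rep_fin hA (Equiv.subtypeUnivEquiv (Pos.isCore hA))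

theorem isEmpty_of_sse {S : Set ℝ} {n : ℕ} {A : Matrix (Fin n) (Fin n) ℝ}
    {q : (n : ℕ) × Matrix (Fin n) (Fin n) ℝ} (hS : ∀ x ∈ S, 0 ≤ x) (h : SSE S ⟨n, A⟩ q)
    (hn : n = 0) : ∀ k, ¬ IsCore q.2 k := by
  induction h with
  | refl => subst hn; exact fun k => k.elim0
  | tail _ h ih =>
    obtain ⟨R, S', hR, hS', e₁, e₂⟩ := h
    intro k hk
    rw [e₂] at hk
    obtain ⟨j, -, hj⟩ := hk.exists_row (fun i j => hS _ (hR i j)) (fun i j => hS _ (hS' i j))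
    rw [← e₁] at hj
    exact ih j hj

open scoped Classical in
theorem eventually_invRel_of_sse {S : Set ℝ} {p q : (n : ℕ) × Matrix (Fin n) (Fin n) ℝ}
    (hS : ∀ x ∈ S, 0 ≤ x) (h : SSE S p q) (hp : NN p.2) (hp' : Prim (trim p.2))
    (hl : ∃ x, 0 < trim p.2 x x) :
    Prim (trim q.2) ∧ (∃ x, 0 < trim q.2 x x) ∧
      ∀ᶠ L in atTop, InvRel L (trim p.2) (trim q.2) := by
  induction h with
  | refl => exact ⟨hp', hl, eventually_invRel_self (fun i j => hp _ _) hp' hl.choose_spec⟩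
  | tail _ h ih =>
    obtain ⟨R, S', hR, hS', e₁, e₂⟩ := h
    rw [e₁] at ih
    rw [e₂]
    obtain ⟨a, ⟨x, hx⟩, c⟩ := ih
    obtain ⟨a', b', c'⟩ := eventually_invRel_trim (fun i j => hS _ (hR i j))
      (fun i j => hS _ (hS' i j)) a ⟨x, hx⟩
    exact ⟨a', b', by filter_upwards [c, c'] with L h₁ h₂ using h₁.trans h₂ hx⟩

end PositiveSSE

/-- Positive square real matrices which are SSE over `ℝ₊` are SSE over `ℝ₊` through
positive matrices. -/
theorem positive_theorem {m k : ℕ}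
    (A : Matrix (Fin m) (Fin m) ℝ) (B : Matrix (Fin k) (Fin k) ℝ)
    (hA : PosEntries A) (hB : PosEntries B)
    (hsse : SSE {x : ℝ | 0 ≤ x} ⟨m, A⟩ ⟨k, B⟩) :
    Relation.ReflTransGen
      (fun p q => PosEntries p.2 ∧ PosEntries q.2 ∧ ESSE {x : ℝ | 0 ≤ x} p q)
      ⟨m, A⟩ ⟨k, B⟩ := by
  classical
  change PositiveSSE.PosSSE _ _
  rcases Nat.eq_zero_or_pos m with rfl | hm
  · have h := PositiveSSE.isEmpty_of_sse (fun _ h => h) hsse rfl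
    obtain rfl : k = 0 := by
      by_contra hk
      exact h ⟨0, Nat.pos_of_ne_zero hk⟩ (PositiveSSE.Pos.isCore hB _)
    rw [Subsingleton.elim A B]
    exact PositiveSSE.PosSSE.refl _
  · have pA : PositiveSSE.Pos (PositiveSSE.trim A) := fun i j => hA _ _
    have pB : PositiveSSE.Pos (PositiveSSE.trim B) := fun i j => hB _ _
    let x : {i // PositiveSSE.IsCore A i} := ⟨⟨0, hm⟩, PositiveSSE.Pos.isCore hA _⟩
    obtain ⟨-, ⟨y, -⟩, h⟩ := PositiveSSE.eventually_invRel_of_sse (fun _ h => h) hsse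
      (PositiveSSE.Pos.nn hA) pA.prim ⟨x, pA x x⟩
    obtain ⟨L, hL⟩ := h.exists
    exact ((PositiveSSE.posSSE_rep_trim hA).trans
      (PositiveSSE.posSSE_of_invRel pA pB x y hL)).trans (PositiveSSE.posSSE_rep_trim hB).symm
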